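/- Let δ be an irreducible non-planar curve of degree e in ℂP^d, d ≥ 3. Then there are at most O(e^3) points x ∈ ℂP^d∖δ such that the projection π_x restricted to δ is not generically one-to-one. -/

import Mathlib

open scoped Pointwise
open Classical

noncomputable section

/-- `n`-dimensional projective space over `𝔽`. -/
abbrev PS (𝔽 : Type) [Field 𝔽] (n : ℕ) := Projectivization 𝔽 (Fin (n + 1) → 𝔽)

/-- A projective flat of projective dimension `r - 1` (linear rank `r`), as a set of points. -/
def IsFlatOfRank {𝔽 : Type} [Field 𝔽] {n : ℕ} (r : ℕ) (S : Set (PS 𝔽 n)) : Prop :=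
  ∃ W : Submodule 𝔽 (Fin (n + 1) → 𝔽), Module.finrank 𝔽 W = r ∧ S = {x | x.submodule ≤ W}

/-- A hyperplane of `PS 𝔽 n`, as a set of points. -/
def IsHypSet {𝔽 : Type} [Field 𝔽] {n : ℕ} (S : Set (PS 𝔽 n)) : Prop := IsFlatOfRank n S

/-- The linear span of a set of projective points. -/
def projSpan {𝔽 : Type} [Field 𝔽] {n : ℕ} (S : Set (PS 𝔽 n)) : Submodule 𝔽 (Fin (n + 1) → 𝔽) :=
  ⨆ x ∈ S, x.submodule

/-- Every `d` points of `P` span a hyperplane (of `PS 𝔽 d`). -/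
def SpanEveryd {𝔽 : Type} [Field 𝔽] {n : ℕ} (d : ℕ) (P : Set (PS 𝔽 n)) : Prop :=
  ∀ S : Set (PS 𝔽 n), S ⊆ P → S.Finite → S.ncard = d → Module.finrank 𝔽 (projSpan S) = d

/-- The hyperplanes passing through exactly `k` points of `P`. -/
def hypThrough {𝔽 : Type} [Field 𝔽] {n : ℕ} (P : Set (PS 𝔽 n)) (k : ℕ) :
    Set (Submodule 𝔽 (Fin (n + 1) → 𝔽)) :=
  {W | Module.finrank 𝔽 W = n ∧ ({x ∈ P | x.submodule ≤ W}).ncard = k}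

/-- The number of hyperplanes passing through exactly `k` points of `P`.
`numHyp P n` is the number of ordinary hyperplanes of `P ⊆ PS 𝔽 n`;
`numHyp P (n+1)` is the number of `(n+1)`-point hyperplanes. -/
def numHyp {𝔽 : Type} [Field 𝔽] {n : ℕ} (P : Set (PS 𝔽 n)) (k : ℕ) : ℕ :=
  (hypThrough P k).ncard
/-- The projective zero locus of a set of (homogeneous) polynomials. -/
def projZeroLocus {n : ℕ} (S : Set (MvPolynomial (Fin (n + 1)) ℂ)) : Set (PS ℂ n) :=
  {x | ∀ f ∈ S, ∀ v ∈ x.submodule, MvPolynomial.eval v f = 0}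

/-- A (closed, projective) algebraic set in `ℂPⁿ`. -/
def IsAlg {n : ℕ} (V : Set (PS ℂ n)) : Prop :=
  ∃ S : Set (MvPolynomial (Fin (n + 1)) ℂ),
    (∀ f ∈ S, ∃ e, f.IsHomogeneous e) ∧ V = projZeroLocus S

/-- The Zariski closure of a set of points of `ℂPⁿ`. -/
def zclosure {n : ℕ} (A : Set (PS ℂ n)) : Set (PS ℂ n) :=
  ⋂₀ {V | IsAlg V ∧ A ⊆ V}

/-- An irreducible algebraic set in `ℂPⁿ`. -/
def IsIrredAlg {n : ℕ} (V : Set (PS ℂ n)) : Prop :=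
  IsAlg V ∧ V.Nonempty ∧
    ∀ V₁ V₂ : Set (PS ℂ n), IsAlg V₁ → IsAlg V₂ → V ⊆ V₁ ∪ V₂ → V ⊆ V₁ ∨ V ⊆ V₂

/-- An irreducible component of an algebraic set. -/
def IsComponentOf {n : ℕ} (C V : Set (PS ℂ n)) : Prop :=
  IsIrredAlg C ∧ C ⊆ V ∧ ∀ C' : Set (PS ℂ n), IsIrredAlg C' → C' ⊆ V → C ⊆ C' → C = C'

/-- `V` is non-degenerate: it is not contained in a hyperplane. -/
def NonDeg {n : ℕ} (V : Set (PS ℂ n)) : Prop := ∀ S : Set (PS ℂ n), IsHypSet S → ¬V ⊆ S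

/-- `V` is non-planar: it is not contained in a 2-flat. -/
def NonPlanar {n : ℕ} (V : Set (PS ℂ n)) : Prop := ∀ S : Set (PS ℂ n), IsFlatOfRank 3 S → ¬V ⊆ S

/-- A projective variety of pure dimension 1: it is algebraic, some hyperplane meets it in
finitely many points (dimension at most 1), and every irreducible component is infinite
(dimension at least 1). -/
def IsPureCurve {n : ℕ} (V : Set (PS ℂ n)) : Prop :=
  IsAlg V ∧ (∃ S : Set (PS ℂ n), IsHypSet S ∧ (V ∩ S).Finite) ∧
    ∀ C, IsComponentOf C V → C.Infinite

/-- A curve of degree `e` in `ℂPⁿ`: a pure 1-dimensional variety such that the maximum number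
of points in a finite intersection with a hyperplane is `e`. -/
def IsCurveDeg {n : ℕ} (V : Set (PS ℂ n)) (e : ℕ) : Prop :=
  IsPureCurve V ∧
    IsGreatest {m : ℕ | ∃ S : Set (PS ℂ n), IsHypSet S ∧ (V ∩ S).Finite ∧ (V ∩ S).ncard = m} e

/-- All homogeneous polynomials vanishing on `V`. -/
def vanishingForms {n : ℕ} (V : Set (PS ℂ n)) : Set (MvPolynomial (Fin (n + 1)) ℂ) :=
  {f | (∃ e, f.IsHomogeneous e) ∧ ∀ x ∈ V, ∀ v ∈ x.submodule, MvPolynomial.eval v f = 0}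

/-- The (affine cone of the) Zariski tangent space of `V` at `x`. -/
def tangentSpaceAt {n : ℕ} (V : Set (PS ℂ n)) (x : PS ℂ n) : Submodule ℂ (Fin (n + 1) → ℂ) :=
  ⨅ f ∈ vanishingForms V,
    LinearMap.ker (∑ i : Fin (n + 1),
      MvPolynomial.eval x.rep (MvPolynomial.pderiv i f) •
        (LinearMap.proj i : (Fin (n + 1) → ℂ) →ₗ[ℂ] ℂ))

/-- A smooth point of a curve `V`: the tangent space has (affine) dimension 2. -/
def IsSmoothPt {n : ℕ} (V : Set (PS ℂ n)) (x : PS ℂ n) : Prop :=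
  x ∈ V ∧ Module.finrank ℂ (tangentSpaceAt V x) = 2

/-- The set of smooth points of a curve `V`. -/
def smoothPts {n : ℕ} (V : Set (PS ℂ n)) : Set (PS ℂ n) := {x | IsSmoothPt V x}

/-- A smooth curve. -/
def IsSmoothCurve {n : ℕ} (V : Set (PS ℂ n)) : Prop := ∀ x ∈ V, IsSmoothPt V x

/-- A real point of `ℂPⁿ`: one admitting a representative vector with real coordinates. -/
def IsRealPt {n : ℕ} (x : PS ℂ n) : Prop := ∃ v ∈ x.submodule, v ≠ 0 ∧ ∀ i, (v i).im = 0

/-- A real curve: each irreducible component contains infinitely many real points. -/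
def IsRealCurve {n : ℕ} (V : Set (PS ℂ n)) : Prop :=
  ∀ C, IsComponentOf C V → {x ∈ C | IsRealPt x}.Infinite

/-- The natural embedding `ℝPⁿ → ℂPⁿ`. -/
def cx {n : ℕ} (x : PS ℝ n) : PS ℂ n :=
  Projectivization.mk ℂ (fun i => (x.rep i : ℂ)) (by
    intro hc
    apply x.rep_nonzero
    funext i
    have h := congrFun hc i
    simp only [Pi.zero_apply] at h ⊢
    exact_mod_cast h)
/-- The image of a set `A ⊆ ℂPⁿ⁺¹` under the projection induced by the linear map `f`. -/
def projImage {n : ℕ} (f : (Fin (n + 2) → ℂ) →ₗ[ℂ] (Fin (n + 1) → ℂ))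
    (A : Set (PS ℂ (n + 1))) : Set (PS ℂ n) :=
  {y | ∃ x ∈ A, ∃ h : f x.rep ≠ 0, y = Projectivization.mk ℂ (f x.rep) h}

/-- The projection induced by `f` is generically one-to-one on `A`: it is injective away
from some finite subset of `A`. -/
def GenOneToOneOn {n : ℕ} (f : (Fin (n + 2) → ℂ) →ₗ[ℂ] (Fin (n + 1) → ℂ))
    (A : Set (PS ℂ (n + 1))) : Prop :=
  ∃ S : Set (PS ℂ (n + 1)), S.Finite ∧
    ∀ x₁ ∈ A \ S, ∀ x₂ ∈ A \ S,
      (∃ c : ℂ, c ≠ 0 ∧ f x₁.rep = c • f x₂.rep) → x₁ = x₂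

namespace ProjCurve

section Basics
open MvPolynomial

variable {d : ℕ}

/-- The linear form attached to a linear functional, as a polynomial. -/
def linPoly (u : (Fin d → ℂ) →ₗ[ℂ] ℂ) : MvPolynomial (Fin d) ℂ :=
  ∑ i, C (u (Pi.single i 1)) * X i

lemma aeval_linPoly {B : Type*} [CommRing B] [Algebra ℂ B] (u : (Fin d → ℂ) →ₗ[ℂ] ℂ)
    (w : Fin d → B) : aeval w (linPoly u) = ∑ i, u (Pi.single i 1) • w i := by
  simp [linPoly, Algebra.smul_def]

lemma apply_eq_sum_single (u : (Fin d → ℂ) →ₗ[ℂ] ℂ) (v : Fin d → ℂ) :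
    u v = ∑ i, u (Pi.single i 1) * v i := by
  conv_lhs => rw [← Finset.univ_sum_single v]
  rw [map_sum]
  refine Finset.sum_congr rfl fun i _ => ?_
  have : (Pi.single i (v i) : Fin d → ℂ) = v i • Pi.single i 1 := by
    rw [← Pi.single_smul]; simp
  rw [this, map_smul, smul_eq_mul, mul_comm]

@[simp] lemma eval_linPoly (u : (Fin d → ℂ) →ₗ[ℂ] ℂ) (v : Fin d → ℂ) :
    eval v (linPoly u) = u v := by
  rw [apply_eq_sum_single]; simp [linPoly]

lemma isHomogeneous_linPoly (u : (Fin d → ℂ) →ₗ[ℂ] ℂ) : (linPoly u).IsHomogeneous 1 :=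
  IsHomogeneous.sum _ _ _ fun _ _ => isHomogeneous_C_mul_X _ _

lemma isHomogeneous_linPoly_pow (u : (Fin d → ℂ) →ₗ[ℂ] ℂ) (k : ℕ) :
    (linPoly u ^ k).IsHomogeneous k := by
  simpa using (isHomogeneous_linPoly u).pow k

lemma linPoly_add (u v : (Fin d → ℂ) →ₗ[ℂ] ℂ) : linPoly (u + v) = linPoly u + linPoly v := by
  simp [linPoly, add_mul, Finset.sum_add_distrib]

lemma linPoly_smul (c : ℂ) (u : (Fin d → ℂ) →ₗ[ℂ] ℂ) : linPoly (c • u) = C c * linPoly u := by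
  simp [linPoly, Finset.mul_sum, mul_assoc]

/-- The polynomial `f` vanishes on the set `Z`. -/
def VanishesOn (Z : Set (Fin d → ℂ)) (f : MvPolynomial (Fin d) ℂ) : Prop :=
  ∀ v ∈ Z, eval v f = 0

/-- The vectors `v i` represent pairwise distinct points of projective space. -/
def ProjDistinct {ι : Type*} (v : ι → Fin d → ℂ) : Prop :=
  (∀ i, v i ≠ 0) ∧ ∀ i j, i ≠ j → ∀ c : ℂ, v i ≠ c • v j

/-- The locus `f = 0` in `Z` contains at most `k` projective points. -/
def ZerosLE (Z : Set (Fin d → ℂ)) (f : MvPolynomial (Fin d) ℂ) (k : ℕ) : Prop :=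
  ∀ (N : ℕ) (v : Fin N → Fin d → ℂ), ProjDistinct v → (∀ i, v i ∈ Z ∧ eval (v i) f = 0) → N ≤ k

/-- The affine cone over an irreducible projective variety. -/
structure IsIrredCone (Z : Set (Fin d → ℂ)) : Prop where
  irred : ∀ f g i j, f.IsHomogeneous i → g.IsHomogeneous j → VanishesOn Z (f * g) →
    VanishesOn Z f ∨ VanishesOn Z g
  closed : ∀ v, (∀ f k, f.IsHomogeneous k → VanishesOn Z f → eval v f = 0) → v ∈ Z

/-- `A` is the coordinate ring of the affine part `ℓ = 1` of the cone `Z`. -/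
structure IsAffineModel (Z : Set (Fin d → ℂ)) (l : (Fin d → ℂ) →ₗ[ℂ] ℂ)
    {A : Type} [CommRing A] [Algebra ℂ A] (π : MvPolynomial (Fin d) ℂ →ₐ[ℂ] A) : Prop where
  surj : Function.Surjective π
  ker_iff : ∀ f k, f.IsHomogeneous k → (π f = 0 ↔ VanishesOn Z f)
  map_l : π (linPoly l) = 1
  eval_eq_zero : ∀ p ∈ Z, l p = 1 → ∀ f, π f = 0 → eval p f = 0

/-- A functional separating a nonzero vector from a vector not proportional to it. -/
lemma exists_functional_separating {v w : Fin d → ℂ} (h : ∀ c : ℂ, v ≠ c • w) :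
    ∃ u : (Fin d → ℂ) →ₗ[ℂ] ℂ, u w = 0 ∧ u v ≠ 0 := by
  have hv : v ∉ Submodule.span ℂ {w} := by
    rw [Submodule.mem_span_singleton]
    rintro ⟨c, hc⟩
    exact h c hc.symm
  obtain ⟨u, hu, hw⟩ := Submodule.exists_le_ker_of_notMem hv
  exact ⟨u, hw (Submodule.mem_span_singleton_self w), hu⟩

/-- Polynomials of total degree at most `k` agree on `ℓ = 1` with forms of degree `k`. -/
lemma IsAffineModel.exists_form {Z : Set (Fin d → ℂ)} {l : (Fin d → ℂ) →ₗ[ℂ] ℂ}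
    {A : Type} [CommRing A] [Algebra ℂ A] {π : MvPolynomial (Fin d) ℂ →ₐ[ℂ] A}
    (h : IsAffineModel Z l π) (f : MvPolynomial (Fin d) ℂ) {k : ℕ} (hk : f.totalDegree ≤ k) :
    ∃ F : MvPolynomial (Fin d) ℂ, F.IsHomogeneous k ∧ π F = π f := by
  refine ⟨∑ i ∈ Finset.range (f.totalDegree + 1),
    homogeneousComponent i f * linPoly l ^ (k - i), ?_, ?_⟩
  · refine IsHomogeneous.sum _ _ _ fun i hi => ?_
    have hi' : i ≤ k := by
      have := Finset.mem_range.1 hi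
      omega
    have := (homogeneousComponent_isHomogeneous i f).mul (isHomogeneous_linPoly_pow l (k - i))
    rwa [Nat.add_sub_cancel' hi'] at this
  · conv_rhs => rw [← sum_homogeneousComponent f]
    simp [h.map_l]

/-- Forms of any degree taking prescribed values at projectively distinct points. -/
lemma exists_dual_forms {N : ℕ} {v : Fin N → Fin d → ℂ} (hv : ProjDistinct v) {k : ℕ}
    (hk : N ≤ k) : ∃ E : Fin N → MvPolynomial (Fin d) ℂ, (∀ i, (E i).IsHomogeneous k) ∧
      ∀ i j, eval (v j) (E i) = if i = j then 1 else 0 := by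
  suffices H : ∀ i, ∃ E : MvPolynomial (Fin d) ℂ, E.IsHomogeneous k ∧
      ∀ j, eval (v j) E = if i = j then 1 else 0 by
    choose E h1 h2 using H
    exact ⟨E, h1, h2⟩
  intro i
  have hu : ∀ j, ∃ u : (Fin d → ℂ) →ₗ[ℂ] ℂ, u (v i) ≠ 0 ∧ (i ≠ j → u (v j) = 0) := by
    intro j
    by_cases hij : i = j
    · obtain ⟨u, -, h⟩ := exists_functional_separating (v := v i) (w := 0)
        (by simpa using hv.1 i)
      exact ⟨u, h, fun h => (h hij).elim⟩
    · obtain ⟨u, h, h'⟩ := exists_functional_separating (hv.2 i j hij)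
      exact ⟨u, h', fun _ => h⟩
  choose u hu1 hu2 using hu
  set G : MvPolynomial (Fin d) ℂ := (∏ j, linPoly (u j)) * linPoly (u i) ^ (k - N) with hG
  have hGi : eval (v i) G ≠ 0 := by
    simp only [hG, map_mul, map_prod, eval_linPoly, map_pow]
    exact mul_ne_zero (Finset.prod_ne_zero_iff.2 fun j _ => hu1 j) (pow_ne_zero _ (hu1 i))
  refine ⟨C (eval (v i) G)⁻¹ * G, ?_, fun j => ?_⟩
  · have h1 : (∏ j, linPoly (u j)).IsHomogeneous N := by
      have := IsHomogeneous.prod Finset.univ (fun j => linPoly (u j)) (fun _ => 1)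
        fun j _ => isHomogeneous_linPoly (u j)
      simpa using this
    have h2 := (h1.mul (isHomogeneous_linPoly_pow (u i) (k - N))).C_mul (eval (v i) G)⁻¹
    rwa [Nat.add_sub_cancel' hk] at h2
  · split_ifs with hij
    · subst hij
      simp [hGi]
    · have : eval (v j) G = 0 := by
        simp only [hG, map_mul, map_prod, eval_linPoly]
        rw [Finset.prod_eq_zero (Finset.mem_univ j) (hu2 j hij), zero_mul]
      simp [this]

/-- Nullstellensatz: a point over an extension field specialises to a complex point, preserving
all polynomial relations and a given polynomial inequation. -/
lemma exists_specialization {Ω : Type*} [Field Ω] [Algebra ℂ Ω] {ι : Type*} [Finite ι]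
    (z : ι → Ω) (h : MvPolynomial ι ℂ) (hh : aeval z h ≠ 0) :
    ∃ c : ι → ℂ, (∀ f : MvPolynomial ι ℂ, aeval z f = 0 → eval c f = 0) ∧ eval c h ≠ 0 := by
  set I : Ideal (MvPolynomial ι ℂ) := RingHom.ker (aeval z : MvPolynomial ι ℂ →ₐ[ℂ] Ω) with hI
  have hp : I.IsPrime := RingHom.ker_isPrime _
  have h1 : h ∉ vanishingIdeal ℂ (zeroLocus ℂ I) := by
    rw [IsPrime.vanishingIdeal_zeroLocus]
    exact hh
  rw [mem_vanishingIdeal_iff] at h1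
  push Not at h1
  obtain ⟨c, hc, hch⟩ := h1
  refine ⟨c, fun f hf => ?_, ?_⟩
  · simpa [aeval_eq_eval] using hc f hf
  · simpa [aeval_eq_eval] using hch

end Basics

section Growth
open MvPolynomial

variable {d : ℕ}

lemma exists_homogeneousComponent_mul {g : MvPolynomial (Fin d) ℂ} {j : ℕ}
    (hg : g.IsHomogeneous j) (a : MvPolynomial (Fin d) ℂ) (k : ℕ) :
    ∃ a' : MvPolynomial (Fin d) ℂ, a'.totalDegree ≤ k - j ∧
      homogeneousComponent k (a * g) = a' * g := by
  have hterm : ∀ i, homogeneousComponent k (homogeneousComponent i a * g) =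
      (if k = i + j then homogeneousComponent i a else 0) * g := by
    intro i
    rw [homogeneousComponent_of_mem ((homogeneousComponent_isHomogeneous i a).mul hg)]
    split_ifs <;> simp
  refine ⟨∑ i ∈ Finset.range (a.totalDegree + 1),
    if k = i + j then homogeneousComponent i a else 0, ?_, ?_⟩
  · refine totalDegree_finsetSum_le fun i _ => ?_
    split_ifs with h
    · exact (homogeneousComponent_isHomogeneous i a).totalDegree_le.trans (by omega)
    · simp
  · conv_lhs => rw [← sum_homogeneousComponent a]
    rw [Finset.sum_mul, map_sum, Finset.sum_mul]
    exact Finset.sum_congr rfl fun i _ => hterm i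

variable {Z : Set (Fin d → ℂ)} {l m : (Fin d → ℂ) →ₗ[ℂ] ℂ}
  {A : Type} [CommRing A] [Algebra ℂ A] {π : MvPolynomial (Fin d) ℂ →ₐ[ℂ] A}

/-- If `l` and `m` have no common zero on the curve, large powers of the coordinates lie in the
ideal generated by `l` and `m`. -/
lemma IsAffineModel.exists_pow_X_eq (h : IsAffineModel Z l π) (hZ : IsIrredCone Z)
    (hlm : ∀ v ∈ Z, l v = 0 → m v = 0 → v = 0) :
    ∃ M : ℕ, ∀ j, ∃ b c : MvPolynomial (Fin d) ℂ, b.totalDegree ≤ M ∧ c.totalDegree ≤ M ∧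
      π (X j ^ (M + 1)) = π b + π (linPoly m) * π c := by
  set S : Set (MvPolynomial (Fin d) ℂ) :=
    {f | (∃ k, f.IsHomogeneous k) ∧ VanishesOn Z f} ∪ {linPoly l, linPoly m} with hS
  have hrad : ∀ j, X j ∈ (Ideal.span S).radical := by
    intro j
    rw [← vanishingIdeal_zeroLocus_eq_radical (K := ℂ), mem_vanishingIdeal_iff]
    intro v hv
    have hv' : ∀ f ∈ S, eval v f = 0 := fun f hf => by
      simpa [aeval_eq_eval] using hv f (Ideal.subset_span hf)
    have hvZ : v ∈ Z := hZ.closed v fun f k hf hfZ => hv' f (Or.inl ⟨⟨k, hf⟩, hfZ⟩)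
    have hv0 : v = 0 := hlm v hvZ (by simpa using hv' (linPoly l) (by simp [hS]))
      (by simpa using hv' (linPoly m) (by simp [hS]))
    simp [hv0]
  choose M hM using hrad
  refine ⟨∑ j, M j, fun j => ?_⟩
  set K := ∑ j, M j
  have hmem : X j ^ (K + 1) ∈ Ideal.span S := by
    have : M j ≤ K := Finset.single_le_sum (f := M) (fun _ _ => Nat.zero_le _) (Finset.mem_univ j)
    exact Ideal.pow_mem_of_pow_mem _ (hM j) (by omega)
  obtain ⟨n, a, s, hs⟩ := Submodule.mem_span_set'.1 hmem
  have hcomp : homogeneousComponent (K + 1) (X j ^ (K + 1) : MvPolynomial (Fin d) ℂ) =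
      X j ^ (K + 1) := by
    rw [homogeneousComponent_of_mem (isHomogeneous_X_pow j (K + 1)), if_pos rfl]
  have key : ∀ i : Fin n, ∃ b c : MvPolynomial (Fin d) ℂ, b.totalDegree ≤ K ∧
      c.totalDegree ≤ K ∧
      π (homogeneousComponent (K + 1) (a i • (s i : MvPolynomial (Fin d) ℂ))) =
        π b + π (linPoly m) * π c := by
    intro i
    rcases (s i).2 with ⟨⟨k, hk⟩, hfZ⟩ | hlm'
    · obtain ⟨a', -, ha'⟩ := exists_homogeneousComponent_mul hk (a i) (K + 1)
      refine ⟨0, 0, by simp, by simp, ?_⟩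
      rw [smul_eq_mul, ha', map_mul, (h.ker_iff _ k hk).2 hfZ]
      simp
    · rcases hlm' with hl | hm
      · rw [hl]
        obtain ⟨a', hd, ha'⟩ :=
          exists_homogeneousComponent_mul (isHomogeneous_linPoly l) (a i) (K + 1)
        exact ⟨a', 0, hd, by simp, by rw [smul_eq_mul, ha', map_mul, h.map_l]; simp⟩
      · rw [Set.mem_singleton_iff.1 hm]
        obtain ⟨a', hd, ha'⟩ :=
          exists_homogeneousComponent_mul (isHomogeneous_linPoly m) (a i) (K + 1)
        exact ⟨0, a', by simp, hd, by rw [smul_eq_mul, ha', map_mul]; simp [mul_comm]⟩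
  choose b c hb hc hbc using key
  refine ⟨∑ i, b i, ∑ i, c i, totalDegree_finsetSum_le fun i _ => hb i,
    totalDegree_finsetSum_le fun i _ => hc i, ?_⟩
  rw [← hcomp, ← hs, map_sum, map_sum, map_sum, map_sum, Finset.mul_sum,
    ← Finset.sum_add_distrib]
  exact Finset.sum_congr rfl fun i _ => hbc i

/-- The image in `A` of the polynomials of total degree at most `k`. -/
def filt (π : MvPolynomial (Fin d) ℂ →ₐ[ℂ] A) (k : ℕ) : Submodule ℂ A :=
  (restrictTotalDegree (Fin d) ℂ k).map π.toLinearMap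

lemma mem_filt {k : ℕ} {a : A} : a ∈ filt π k ↔ ∃ f, f.totalDegree ≤ k ∧ π f = a := by
  simp [filt, mem_restrictTotalDegree]

instance (k : ℕ) : FiniteDimensional ℂ (filt π k) := by
  unfold filt; infer_instance

lemma filt_mono {j k : ℕ} (hjk : j ≤ k) : filt π j ≤ filt π k := by
  intro a ha
  obtain ⟨f, hf, rfl⟩ := mem_filt.1 ha
  exact mem_filt.2 ⟨f, hf.trans hjk, rfl⟩

lemma IsAffineModel.exists_mem_filt (h : IsAffineModel Z l π) (a : A) : ∃ k, a ∈ filt π k := by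
  obtain ⟨f, rfl⟩ := h.surj a
  exact ⟨_, mem_filt.2 ⟨f, le_rfl, rfl⟩⟩

/-- From some degree on, the filtration grows only by multiplication with `m / l`. -/
lemma IsAffineModel.exists_filt_succ_le (h : IsAffineModel Z l π) (hZ : IsIrredCone Z)
    (hlm : ∀ v ∈ Z, l v = 0 → m v = 0 → v = 0) :
    ∃ K : ℕ, ∀ k, K ≤ k → filt π (k + 1) ≤
      filt π k ⊔ (filt π k).map (LinearMap.mulLeft ℂ (π (linPoly m))) := by
  obtain ⟨M, hM⟩ := h.exists_pow_X_eq hZ hlm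
  refine ⟨d * M, fun k hk => ?_⟩
  set W := filt π k ⊔ (filt π k).map (LinearMap.mulLeft ℂ (π (linPoly m)))
  intro a ha
  obtain ⟨f, hf, rfl⟩ := mem_filt.1 ha
  rw [f.as_sum, map_sum]
  refine Submodule.sum_mem _ fun α hα => ?_
  have hαdeg : α.degree ≤ k + 1 := by
    have := le_totalDegree hα
    rw [Finsupp.sum] at this
    rw [Finsupp.degree]
    exact this.trans hf
  have hmono : ∀ β : Fin d →₀ ℕ, ∀ r : ℂ, (monomial β r).totalDegree ≤ β.degree := fun β r => by
    exact totalDegree_monomial_le β r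
  rcases Nat.lt_or_ge α.degree (k + 1) with hlt | hge
  · exact Submodule.mem_sup_left (mem_filt.2 ⟨_, (hmono _ _).trans (by omega), rfl⟩)
  · obtain ⟨j, hj⟩ : ∃ j, M + 1 ≤ α j := by
      by_contra hcon
      push Not at hcon
      have : α.degree ≤ d * M := by
        rw [Finsupp.degree_eq_sum]
        calc ∑ i, α i ≤ ∑ _i : Fin d, M := Finset.sum_le_sum fun i _ => by
              have := hcon i; omega
          _ = d * M := by simp
      omega
    obtain ⟨b, c, hb, hc, hbc⟩ := hM j
    set β : Fin d →₀ ℕ := α - Finsupp.single j (M + 1) with hβ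
    have hαβ : Finsupp.single j (M + 1) + β = α :=
      add_tsub_cancel_of_le (Finsupp.single_le_iff.2 hj)
    have hβdeg : β.degree + (M + 1) = k + 1 := by
      have := congrArg Finsupp.degree hαβ
      simp only [map_add, Finsupp.degree_single] at this
      omega
    have hfac : monomial α (coeff α f) = X j ^ (M + 1) * monomial β (coeff α f) := by
      rw [X_pow_eq_monomial, monomial_mul, hαβ, one_mul]
    rw [hfac, map_mul, hbc, add_mul, mul_assoc]
    refine Submodule.add_mem_sup (mem_filt.2 ⟨b * monomial β (coeff α f), ?_, by simp⟩)
      ⟨π c * π (monomial β (coeff α f)),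
        mem_filt.2 ⟨c * monomial β (coeff α f), ?_, by simp⟩, by simp⟩
    · refine (totalDegree_mul _ _).trans ?_
      have := hmono β (coeff α f); omega
    · refine (totalDegree_mul _ _).trans ?_
      have := hmono β (coeff α f); omega

end Growth

section Bezout
open MvPolynomial

variable {d : ℕ} {Z : Set (Fin d → ℂ)} {l m : (Fin d → ℂ) →ₗ[ℂ] ℂ}
  {A : Type} [CommRing A] [Algebra ℂ A] {π : MvPolynomial (Fin d) ℂ →ₐ[ℂ] A}

lemma IsAffineModel.finrank_filt_add_le [IsDomain A] (h : IsAffineModel Z l π)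
    {g : MvPolynomial (Fin d) ℂ} {j : ℕ} (hg : g.IsHomogeneous j) (hgZ : ¬ VanishesOn Z g)
    {N : ℕ} {v : Fin N → Fin d → ℂ} (hv : ProjDistinct v) (hvZ : ∀ i, v i ∈ Z ∧ eval (v i) g = 0)
    {k : ℕ} (hk : N ≤ k) :
    Module.finrank ℂ (filt π k) + N ≤ Module.finrank ℂ (filt π (k + j)) := by
  obtain ⟨E, hE, hEv⟩ := exists_dual_forms hv (k := k + j) (by omega)
  have hg0 : π g ≠ 0 := fun h0 => hgZ ((h.ker_iff g j hg).1 h0)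
  let φ : (filt π k × (Fin N → ℂ)) →ₗ[ℂ] filt π (k + j) :=
    LinearMap.codRestrict _
      (((LinearMap.mulLeft ℂ (π g)).comp (filt π k).subtype).coprod
        (Fintype.linearCombination ℂ fun i => π (E i)))
      (by
        rintro ⟨⟨a, ha⟩, c⟩
        obtain ⟨f, hf, rfl⟩ := mem_filt.1 ha
        refine add_mem (mem_filt.2 ⟨g * f, ?_, by simp⟩) ?_
        · have := hg.totalDegree_le
          exact (totalDegree_mul _ _).trans (by omega)
        · rw [LinearMap.comp_apply, LinearMap.snd_apply, Fintype.linearCombination_apply]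
          exact Submodule.sum_mem _ fun i _ => Submodule.smul_mem _ _
            (mem_filt.2 ⟨E i, (hE i).totalDegree_le, rfl⟩))
  have hφ : Function.Injective φ := by
    rw [← LinearMap.ker_eq_bot, LinearMap.ker_eq_bot']
    rintro ⟨⟨a, ha⟩, c⟩ h0
    obtain ⟨f, hf, rfl⟩ := mem_filt.1 ha
    obtain ⟨F, hF, hFf⟩ := h.exists_form f hf
    have h0' : π g * π f + ∑ i, c i • π (E i) = 0 := by
      have := congrArg Subtype.val h0
      simpa [φ, Fintype.linearCombination_apply] using this
    have hform : (F * g + ∑ i, C (c i) * E i).IsHomogeneous (k + j) :=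
      (hF.mul hg).add (IsHomogeneous.sum _ _ _ fun i _ => (hE i).C_mul (c i))
    have hπ : π (F * g + ∑ i, C (c i) * E i) = 0 := by
      rw [map_add, map_mul, hFf, map_sum, mul_comm, ← h0']
      congr 1
      refine Finset.sum_congr rfl fun i _ => ?_
      rw [map_mul, Algebra.smul_def]
      congr 1
      exact π.commutes _
    have hvan := (h.ker_iff _ _ hform).1 hπ
    have hc : c = 0 := by
      funext i
      have := hvan (v i) (hvZ i).1
      simpa [(hvZ i).2, hEv] using this
    subst hc
    have : π f = 0 := by simpa [hg0] using h0'
    ext <;> simp [this]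
  have := LinearMap.finrank_le_finrank_of_injective hφ
  simpa using this

variable [Algebra (Polynomial ℂ) A] [IsScalarTower ℂ (Polynomial ℂ) A]

lemma IsAffineModel.module_finite (h : IsAffineModel Z l π) (hZ : IsIrredCone Z)
    (hlm : ∀ v ∈ Z, l v = 0 → m v = 0 → v = 0)
    (ht : algebraMap (Polynomial ℂ) A Polynomial.X = π (linPoly m)) :
    Module.Finite (Polynomial ℂ) A := by
  obtain ⟨K, hK⟩ := h.exists_filt_succ_le hZ hlm
  obtain ⟨S, hS⟩ : (filt π K).FG := Module.Finite.iff_fg.1 inferInstance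
  have hW : ∀ j, ∀ a ∈ filt π (K + j), a ∈ Submodule.span (Polynomial ℂ) (S : Set A) := by
    intro j
    induction j with
    | zero =>
      intro a ha
      rw [add_zero, ← hS] at ha
      exact Submodule.span_subset_span ℂ (Polynomial ℂ) _ ha
    | succ j ih =>
      intro a ha
      obtain ⟨b, hb, c, ⟨c', hc', rfl⟩, rfl⟩ := Submodule.mem_sup.1 (hK (K + j) (by omega) ha)
      refine add_mem (ih b hb) ?_
      have := Submodule.smul_mem _ (Polynomial.X : Polynomial ℂ) (ih c' hc')
      rwa [Algebra.smul_def, ht] at this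
  refine ⟨⟨S, eq_top_iff.2 fun a _ => ?_⟩⟩
  obtain ⟨k, hk⟩ := h.exists_mem_filt a
  exact hW k a (filt_mono (by omega) hk)

lemma IsAffineModel.algebraMap_injective [IsDomain A] (h : IsAffineModel Z l π)
    (hZ : IsIrredCone Z) (hlm : ∀ v ∈ Z, l v = 0 → m v = 0 → v = 0)
    (ht : algebraMap (Polynomial ℂ) A Polynomial.X = π (linPoly m))
    (h2 : ∃ v ∈ Z, ∃ w ∈ Z, w ≠ 0 ∧ ∀ c : ℂ, v ≠ c • w) :
    Function.Injective (algebraMap (Polynomial ℂ) A) := by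
  rw [injective_iff_map_eq_zero]
  by_contra hcon
  push Not at hcon
  obtain ⟨p, hp, hp0⟩ := hcon
  have hfin := h.module_finite hZ hlm ht
  have haev : ∀ q : Polynomial ℂ,
      algebraMap (Polynomial ℂ) A q = Polynomial.aeval (π (linPoly m)) q := by
    intro q
    rw [← ht, Polynomial.aeval_algebraMap_apply]
    simp
  have htalg : IsIntegral ℂ (π (linPoly m)) :=
    IsAlgebraic.isIntegral ⟨p, hp0, by rw [← haev]; exact hp⟩
  have hintegral : Algebra.IsIntegral ℂ A := by
    refine ⟨fun a => ?_⟩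
    have ha : IsIntegral (Polynomial ℂ) a := Algebra.IsIntegral.isIntegral a
    have hr : ∀ q : Polynomial ℂ, IsIntegral ℂ (algebraMap (Polynomial ℂ) A q) := fun q => by
      rw [haev]
      exact IsIntegral.of_mem_of_fg _ htalg.fg_adjoin_singleton _
        (Polynomial.aeval_mem_adjoin_singleton ℂ _)
    obtain ⟨q, hq, hqa⟩ := ha
    have hcoe : ∀ i, (q.map (algebraMap (Polynomial ℂ) A)).coeff i ∈ integralClosure ℂ A := by
      intro i
      rw [Polynomial.coeff_map]
      exact hr _
    obtain ⟨q', hq', -, hmon⟩ := Polynomial.lifts_and_natDegree_eq_and_monic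
      (f := algebraMap (integralClosure ℂ A) A) (p := q.map (algebraMap (Polynomial ℂ) A))
      ((Polynomial.lifts_iff_coeff_lifts _).2 fun i => ⟨⟨_, hcoe i⟩, rfl⟩) (hq.map _)
    have : IsIntegral (integralClosure ℂ A) a := by
      refine ⟨q', hmon, ?_⟩
      rw [Polynomial.eval₂_eq_eval_map, hq', ← Polynomial.eval₂_eq_eval_map]
      exact hqa
    exact isIntegral_trans a this
  have hsurj := (IsAlgClosed.algebraMap_bijective_of_isIntegral (k := ℂ) (K := A)).2
  choose c hc using fun i => hsurj (π (X i))
  obtain ⟨v, hv, w, hw, hw0, hvw⟩ := h2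
  have key : ∀ v ∈ Z, v ∈ Submodule.span ℂ {c} := by
    intro v hv
    by_contra hvc
    obtain ⟨u, hu, hk⟩ := Submodule.exists_le_ker_of_notMem hvc
    have huc : u c = 0 := hk (Submodule.mem_span_singleton_self c)
    have : π (linPoly u) = 0 := by
      have h1 : π (linPoly u) = algebraMap ℂ A (u c) := by
        rw [apply_eq_sum_single u c, linPoly, map_sum, map_sum]
        refine Finset.sum_congr rfl fun i _ => ?_
        rw [map_mul, map_mul, hc]
        congr 1
        exact π.commutes _
      rw [h1, huc, map_zero]
    have h3 := (h.ker_iff _ 1 (isHomogeneous_linPoly u)).1 this v hv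
    rw [eval_linPoly] at h3
    exact hu h3
  obtain ⟨a, rfl⟩ := Submodule.mem_span_singleton.1 (key v hv)
  obtain ⟨b, rfl⟩ := Submodule.mem_span_singleton.1 (key w hw)
  have hb : b ≠ 0 := by rintro rfl; simp at hw0
  exact hvw (a / b) (by rw [smul_smul, div_mul_cancel₀ _ hb])

/-- The Hilbert function of the curve grows at most linearly, with slope the rank. -/
lemma IsAffineModel.exists_finrank_filt_le (h : IsAffineModel Z l π) (hZ : IsIrredCone Z)
    (hlm : ∀ v ∈ Z, l v = 0 → m v = 0 → v = 0)
    (ht : algebraMap (Polynomial ℂ) A Polynomial.X = π (linPoly m))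
    [Module.Free (Polynomial ℂ) A] :
    ∃ c, ∀ k, Module.finrank ℂ (filt π k) ≤ Module.finrank (Polynomial ℂ) A * (k + c) := by
  have hfin := h.module_finite hZ hlm ht
  set r := Module.finrank (Polynomial ℂ) A
  let b : Module.Basis (Fin r) (Polynomial ℂ) A := Module.finBasis (Polynomial ℂ) A
  let D : ℕ → Submodule ℂ A := fun n =>
    (Submodule.pi Set.univ (fun _ : Fin r => Polynomial.degreeLT ℂ n)).comap
      (b.equivFun.toLinearMap.restrictScalars ℂ)
  have hD : ∀ n a, a ∈ D n ↔ ∀ i, (b.repr a i).degree < n := by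
    intro n a
    simp [D, Submodule.mem_pi, Polynomial.mem_degreeLT]
  have hDmono : ∀ n n' a, n ≤ n' → a ∈ D n → a ∈ D n' := by
    intro n n' a hn ha
    rw [hD] at ha ⊢
    exact fun i => (ha i).trans_le (by exact_mod_cast hn)
  have hDex : ∀ a, ∃ n, a ∈ D n := by
    intro a
    refine ⟨∑ i, ((b.repr a i).natDegree + 1), (hD _ _).2 fun i => ?_⟩
    refine Polynomial.degree_le_natDegree.trans_lt ?_
    have : (b.repr a i).natDegree + 1 ≤ ∑ i, ((b.repr a i).natDegree + 1) :=
      Finset.single_le_sum (f := fun i => (b.repr a i).natDegree + 1)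
        (fun _ _ => Nat.zero_le _) (Finset.mem_univ i)
    exact_mod_cast this
  have hDfin : ∀ n (W : Submodule ℂ A), W ≤ D n → Module.finrank ℂ W ≤ r * n := by
    intro n W hW
    let φ : W →ₗ[ℂ] (Fin r → Polynomial.degreeLT ℂ n) :=
      LinearMap.pi fun i => LinearMap.codRestrict _
        ((LinearMap.proj i).comp ((b.equivFun.toLinearMap.restrictScalars ℂ).comp W.subtype))
        (fun w => by
          have := (hD n w).1 (hW w.2) i
          simpa [Polynomial.mem_degreeLT] using this)
    have hφ : Function.Injective φ := by
      intro x y hxy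
      apply Subtype.ext
      apply b.equivFun.injective
      funext i
      have := congrArg Subtype.val (congrFun hxy i)
      simpa [φ] using this
    have hfd : FiniteDimensional ℂ (Polynomial.degreeLT ℂ n) :=
      Module.Finite.equiv (Polynomial.degreeLTEquiv ℂ n).symm
    refine (LinearMap.finrank_le_finrank_of_injective hφ).trans ?_
    rw [Module.finrank_pi_fintype]
    simp [(Polynomial.degreeLTEquiv ℂ n).finrank_eq]
  obtain ⟨K, hK⟩ := h.exists_filt_succ_le hZ hlm
  obtain ⟨S, hS⟩ : (filt π K).FG := Module.Finite.iff_fg.1 inferInstance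
  choose n hn using hDex
  set c := ∑ s ∈ S, n s
  have hbase : filt π K ≤ D c := by
    rw [← hS, Submodule.span_le]
    intro s hs
    exact hDmono _ _ _ (Finset.single_le_sum (f := n) (fun _ _ => Nat.zero_le _) hs) (hn s)
  have hstep : ∀ j, filt π (K + j) ≤ D (c + j) := by
    intro j
    induction j with
    | zero => simpa using hbase
    | succ j ih =>
      intro a ha
      obtain ⟨x, hx, y, ⟨y', hy', rfl⟩, rfl⟩ := Submodule.mem_sup.1 (hK (K + j) (by omega) ha)
      refine add_mem (hDmono _ _ _ (by omega) (ih hx)) ?_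
      have hy := (hD _ _).1 (ih hy')
      refine (hD _ _).2 fun i => ?_
      have h1 : LinearMap.mulLeft ℂ (π (linPoly m)) y' = (Polynomial.X : Polynomial ℂ) • y' := by
        rw [Algebra.smul_def, ht]; rfl
      rw [h1, map_smul, Finsupp.smul_apply, smul_eq_mul, mul_comm, Polynomial.degree_mul,
        Polynomial.degree_X]
      have := WithBot.add_lt_add_right WithBot.one_ne_bot (hy i)
      exact_mod_cast this
  refine ⟨c, fun k => hDfin _ _ fun a ha => ?_⟩
  rcases le_or_gt k K with hkK | hkK
  · exact hDmono c _ _ (by omega) (hbase (filt_mono hkK ha))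
  · have := hstep (k - K) (filt_mono (by omega) ha)
    exact hDmono _ _ _ (by omega) this

/-- Bezout: a form of degree `j` not vanishing on the curve has at most `r * j` zeros on it. -/
lemma IsAffineModel.zerosLE [IsDomain A] (h : IsAffineModel Z l π) (hZ : IsIrredCone Z)
    (hlm : ∀ v ∈ Z, l v = 0 → m v = 0 → v = 0)
    (ht : algebraMap (Polynomial ℂ) A Polynomial.X = π (linPoly m))
    [Module.Free (Polynomial ℂ) A]
    {g : MvPolynomial (Fin d) ℂ} {j : ℕ} (hg : g.IsHomogeneous j) (hgZ : ¬ VanishesOn Z g) :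
    ZerosLE Z g (Module.finrank (Polynomial ℂ) A * j) := by
  obtain ⟨c, hc⟩ := h.exists_finrank_filt_le hZ hlm ht
  set r := Module.finrank (Polynomial ℂ) A
  intro N v hv hvZ
  have hiter : ∀ i, i * N ≤ Module.finrank ℂ (filt π (N + i * j)) := by
    intro i
    induction i with
    | zero => simp
    | succ i ih =>
      have := h.finrank_filt_add_le hg hgZ hv hvZ (k := N + i * j) (by omega)
      rw [show N + (i + 1) * j = N + i * j + j by ring, show (i + 1) * N = i * N + N by ring]
      omega
  by_contra hcon
  push Not at hcon
  have h1 := (hiter (r * (N + c) + 1)).trans (hc _)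
  nlinarith [Nat.mul_le_mul_left (r * (N + c) + 1) (Nat.succ_le_of_lt hcon)]

end Bezout

section Degree
open MvPolynomial

/-- A domain finite of rank `r` over `ℂ[X]` has `r` embeddings in an algebraically closed field. -/
lemma exists_embeddings (A : Type) [CommRing A] [IsDomain A] [Algebra (Polynomial ℂ) A]
    [Module.Finite (Polynomial ℂ) A] [Module.Free (Polynomial ℂ) A]
    (hinj : Function.Injective (algebraMap (Polynomial ℂ) A)) :
    ∃ (Ω : Type) (_ : Field Ω) (_ : Algebra (Polynomial ℂ) Ω)
      (σ : Fin (Module.finrank (Polynomial ℂ) A) → (A →ₐ[Polynomial ℂ] Ω)),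
      Function.Injective σ := by
  have : FaithfulSMul (Polynomial ℂ) A := (faithfulSMul_iff_algebraMap_injective _ _).2 hinj
  let k := FractionRing (Polynomial ℂ)
  let K := FractionRing A
  let _ : Algebra k K := FractionRing.liftAlgebra (Polynomial ℂ) K
  have hfr : Module.finrank k K = Module.finrank (Polynomial ℂ) A :=
    IsFractionRing.finrank_eq (Polynomial ℂ) k A K
  have : FiniteDimensional k K := by
    refine FiniteDimensional.of_finrank_pos ?_
    rw [hfr]
    exact Module.finrank_pos
  let Ω := AlgebraicClosure K
  have hcard : Fintype.card (K →ₐ[k] Ω) = Module.finrank (Polynomial ℂ) A := by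
    rw [← hfr]; exact AlgHom.card k K Ω
  let _ : Algebra (Polynomial ℂ) Ω := ((algebraMap k Ω).comp (algebraMap (Polynomial ℂ) k)).toAlgebra
  let e : Fin (Module.finrank (Polynomial ℂ) A) ≃ (K →ₐ[k] Ω) :=
    (Fintype.equivFinOfCardEq hcard).symm
  refine ⟨Ω, inferInstance, inferInstance, fun i =>
    { toRingHom := (e i).toRingHom.comp (algebraMap A K), commutes' := fun p => ?_ }, ?_⟩
  · change e i (algebraMap A K (algebraMap (Polynomial ℂ) A p)) =
      algebraMap k Ω (algebraMap (Polynomial ℂ) k p)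
    rw [← IsScalarTower.algebraMap_apply, IsScalarTower.algebraMap_apply (Polynomial ℂ) k K]
    exact (e i).commutes _
  · intro i j hij
    apply e.injective
    apply AlgHom.coe_ringHom_injective
    apply IsFractionRing.ringHom_ext (A := A)
    intro a
    exact congrArg (fun f => f a) hij

variable {d : ℕ} {Z : Set (Fin d → ℂ)} {l m : (Fin d → ℂ) →ₗ[ℂ] ℂ}
  {A : Type} [CommRing A] [Algebra ℂ A] {π : MvPolynomial (Fin d) ℂ →ₐ[ℂ] A}

lemma projDistinct_of_apply_eq_one {ι : Type*} {v : ι → Fin d → ℂ} (hv : Function.Injective v)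
    (hl : ∀ i, l (v i) = 1) : ProjDistinct v := by
  refine ⟨fun i hi => ?_, fun i j hij c hc => ?_⟩
  · have := hl i
    simp [hi] at this
  · have h1 := hl i
    rw [hc, map_smul, hl j, smul_eq_mul, mul_one] at h1
    rw [h1, one_smul] at hc
    exact hij (hv hc)

/-- A general hyperplane section: `r` distinct points of the curve on a hyperplane `m = c l`. -/
lemma IsAffineModel.exists_section [IsDomain A]
    [Algebra (Polynomial ℂ) A] [IsScalarTower ℂ (Polynomial ℂ) A]
    [Module.Finite (Polynomial ℂ) A] [Module.Free (Polynomial ℂ) A]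
    (h : IsAffineModel Z l π) (hZ : IsIrredCone Z)
    (hinj : Function.Injective (algebraMap (Polynomial ℂ) A))
    (ht : algebraMap (Polynomial ℂ) A Polynomial.X = π (linPoly m)) :
    ∃ (c : ℂ) (v : Fin (Module.finrank (Polynomial ℂ) A) → Fin d → ℂ), ProjDistinct v ∧
      ∀ i, v i ∈ Z ∧ (m - c • l) (v i) = 0 := by
  let r := Module.finrank (Polynomial ℂ) A
  obtain ⟨Ω, _, _, σ, hσ⟩ := exists_embeddings A hinj
  let _ : Algebra ℂ Ω := Algebra.compHom Ω (algebraMap ℂ (Polynomial ℂ))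
  have hC : IsScalarTower ℂ (Polynomial ℂ) Ω := IsScalarTower.of_algebraMap_eq fun _ => rfl
  let τ : Fin r → (A →ₐ[ℂ] Ω) := fun i => (σ i).restrictScalars ℂ
  let z : Fin r × Fin d → Ω := fun p => τ p.1 (π (X p.2))
  have hz : ∀ i (f : MvPolynomial (Fin d) ℂ), aeval z (rename (Prod.mk i) f) = τ i (π f) := by
    intro i f
    rw [aeval_rename]
    change _ = ((τ i).comp π) f
    congr 1
    ext j
    simp [z]
  have hsep : ∀ i j, ∃ a : Fin d, i ≠ j → z (i, a) ≠ z (j, a) := by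
    intro i j
    by_cases hij : i = j
    · have hd : Nonempty (Fin d) := by
        by_contra hne
        have : IsEmpty (Fin d) := not_nonempty_iff.1 hne
        have := h.map_l
        simp [linPoly] at this
      exact ⟨hd.some, fun h => (h hij).elim⟩
    · by_contra hcon
      push Not at hcon
      apply hij
      apply hσ
      ext b
      obtain ⟨f, rfl⟩ := h.surj b
      have : (τ i).comp π = (τ j).comp π := by
        ext a
        exact (hcon a).2
      exact congrArg (fun φ => φ f) this
  choose a ha using hsep
  let P : MvPolynomial (Fin r × Fin d) ℂ :=
    ∏ i, ∏ j, if i = j then 1 else X (i, a i j) - X (j, a i j)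
  have hP : aeval z P ≠ 0 := by
    simp only [P, map_prod]
    refine Finset.prod_ne_zero_iff.2 fun i _ => Finset.prod_ne_zero_iff.2 fun j _ => ?_
    split_ifs with hij
    · simp
    · simpa [sub_eq_zero] using ha i j hij
  obtain ⟨c, hc, hcP⟩ := exists_specialization z P hP
  let v : Fin r → Fin d → ℂ := fun i j => c (i, j)
  have hv : ∀ i (f : MvPolynomial (Fin d) ℂ), eval c (rename (Prod.mk i) f) = eval (v i) f := by
    intro i f
    rw [eval_rename]
    rfl
  have hvf : ∀ i (f : MvPolynomial (Fin d) ℂ), π f = 0 → eval (v i) f = 0 := by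
    intro i f hf
    rw [← hv]
    exact hc _ (by rw [hz, hf, map_zero])
  have hvZ : ∀ i, v i ∈ Z := fun i =>
    hZ.closed _ fun f k hf hfZ => hvf i f ((h.ker_iff f k hf).2 hfZ)
  have hvl : ∀ i, l (v i) = 1 := by
    intro i
    have := hvf i (linPoly l - 1) (by rw [map_sub, h.map_l, map_one, sub_self])
    simpa [sub_eq_zero] using this
  have hvm : ∀ i j, m (v i) = m (v j) := by
    intro i j
    have := hc (rename (Prod.mk i) (linPoly m) - rename (Prod.mk j) (linPoly m)) (by
      rw [map_sub, hz, hz, ← ht]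
      change σ i _ - σ j _ = 0
      rw [AlgHom.commutes, AlgHom.commutes, sub_self])
    rw [map_sub, hv, hv, eval_linPoly, eval_linPoly] at this
    exact sub_eq_zero.1 this
  have hvinj : Function.Injective v := by
    intro i j hij
    by_contra hne
    apply hcP
    simp only [P, map_prod]
    refine Finset.prod_eq_zero (Finset.mem_univ i) (Finset.prod_eq_zero (Finset.mem_univ j) ?_)
    have := congrFun hij (a i j)
    simp only [v] at this
    simp [hne, this]
  have hr : 0 < r := Module.finrank_pos
  refine ⟨m (v ⟨0, hr⟩), v, projDistinct_of_apply_eq_one hvinj hvl, fun i => ⟨hvZ i, ?_⟩⟩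
  simp [hvl i, hvm i ⟨0, hr⟩]

end Degree

section Derivation
open Polynomial

lemma derivation_eval {L : Type*} [Field L] [Algebra ℂ L] (D : Derivation ℂ L L) {t : L}
    (ht : D t = 1) (q : L[X]) (hq : ∀ i, D (q.coeff i) = 0) :
    D (q.eval t) = (derivative q).eval t := by
  rw [derivative_eval, eval_eq_sum, Polynomial.sum, Polynomial.sum, map_sum]
  refine Finset.sum_congr rfl fun i _ => ?_
  rw [Derivation.leibniz, hq, Derivation.leibniz_pow, ht]
  simp only [smul_eq_mul, nsmul_eq_mul]
  ring

lemma eq_zero_of_eval_eq_zero {L : Type*} [Field L] [Algebra ℂ L] (D : Derivation ℂ L L) {t : L}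
    (ht : D t = 1) (n : ℕ) : ∀ q : L[X], q.natDegree ≤ n → (∀ i, D (q.coeff i) = 0) →
      q.eval t = 0 → q = 0 := by
  have : CharZero L := charZero_of_injective_algebraMap (algebraMap ℂ L).injective
  have hconst : ∀ q : L[X], q.natDegree = 0 → q.eval t = 0 → q = 0 := by
    intro q hq h0
    rw [eq_C_of_natDegree_eq_zero hq] at h0 ⊢
    rw [eval_C] at h0
    rw [h0, C_0]
  induction n with
  | zero => exact fun q hq _ h0 => hconst q (by omega) h0
  | succ n ih =>
    intro q hq hD h0
    have hder : (derivative q).eval t = 0 := by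
      rw [← derivation_eval D ht q hD, h0, map_zero]
    have hder0 : derivative q = 0 := by
      refine ih _ ((natDegree_derivative_le q).trans (by omega)) (fun i => ?_) hder
      rw [coeff_derivative, Derivation.leibniz, hD]
      have : D ((i : L) + 1) = 0 := by simp
      simp [this]
    exact hconst q (derivative_eq_zero.1 hder0) h0

/-- The derivation `d/dt` extends to algebraic extensions of `ℂ(t)`, with constants `ℂ`. -/
lemma exists_derivation (L : Type) [Field L] [Algebra ℂ L] [Algebra ℂ[X] L]
    [IsScalarTower ℂ ℂ[X] L] (hinj : Function.Injective (algebraMap ℂ[X] L))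
    [Algebra.IsAlgebraic ℂ[X] L] :
    ∃ D : Derivation ℂ L L, D (algebraMap ℂ[X] L X) = 1 ∧
      ∀ y, D y = 0 → y ∈ Set.range (algebraMap ℂ L) := by
  have : FaithfulSMul ℂ[X] L := (faithfulSMul_iff_algebraMap_injective _ _).2 hinj
  let k := FractionRing ℂ[X]
  let _ : Algebra k L := FractionRing.liftAlgebra ℂ[X] L
  have : Algebra.IsAlgebraic k L := .extendScalars (FaithfulSMul.algebraMap_injective ℂ[X] k)
  have : CharZero k := charZero_of_injective_algebraMap (FaithfulSMul.algebraMap_injective ℂ[X] k)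
  have : Algebra.FormallyEtale ℂ[X] k := .of_isLocalization (nonZeroDivisors ℂ[X])
  have : Algebra.FormallyEtale k L := .of_isSeparable k L
  have : Algebra.FormallyEtale ℂ[X] L := .comp ℂ[X] k L
  let d0 : Derivation ℂ ℂ[X] L := mkDerivation ℂ (1 : L)
  let φ := (d0.liftKaehlerDifferential.liftBaseChange L).comp
    (KaehlerDifferential.tensorKaehlerEquivOfFormallyEtale ℂ ℂ[X] L).symm.toLinearMap
  let D : Derivation ℂ L L := φ.compDer (KaehlerDifferential.D ℂ L)
  have hD : D (algebraMap ℂ[X] L X) = 1 := by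
    change d0.liftKaehlerDifferential.liftBaseChange L
      ((KaehlerDifferential.tensorKaehlerEquivOfFormallyEtale ℂ ℂ[X] L).symm
        (KaehlerDifferential.D ℂ L (algebraMap ℂ[X] L X))) = 1
    rw [KaehlerDifferential.tensorKaehlerEquivOfFormallyEtale_symm_D_algebraMap,
      LinearMap.liftBaseChange_tmul, Derivation.liftKaehlerDifferential_comp_D]
    simp [d0, mkDerivation_X]
  refine ⟨D, hD, fun y hy => ?_⟩
  obtain ⟨p, hp0, hpy⟩ := Algebra.IsAlgebraic.isAlgebraic (R := ℂ[X]) y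
  let q : L[X] := ∑ j ∈ p.support, C (y ^ j) * (p.coeff j).map (algebraMap ℂ L)
  have hcoeff : ∀ i, q.coeff i =
      ∑ j ∈ p.support, y ^ j * algebraMap ℂ L ((p.coeff j).coeff i) := by
    intro i
    simp only [q, finsetSum_coeff, coeff_C_mul, coeff_map]
  have hq0 : q = 0 := by
    refine eq_zero_of_eval_eq_zero D hD q.natDegree q le_rfl (fun i => ?_) ?_
    · rw [hcoeff, map_sum]
      refine Finset.sum_eq_zero fun j _ => ?_
      rw [Derivation.leibniz, Derivation.map_algebraMap, Derivation.leibniz_pow, hy]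
      simp
    · have hev : ∀ f : ℂ[X], (f.map (algebraMap ℂ L)).eval (algebraMap ℂ[X] L X) =
          algebraMap ℂ[X] L f := by
        intro f
        rw [eval_map_algebraMap, aeval_algebraMap_apply, aeval_X_left_apply]
      rw [← hpy, aeval_eq_sum_range' (lt_add_one _)]
      simp only [q, eval_finsetSum, eval_mul, eval_C, hev]
      rw [Finset.sum_subset (s₂ := Finset.range (p.natDegree + 1))]
      · refine Finset.sum_congr rfl fun j _ => ?_
        rw [Algebra.smul_def, mul_comm]
      · intro j hj
        have := le_natDegree_of_mem_supp j hj
        simp; omega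
      · intro j _ hj
        simp [notMem_support_iff.1 hj]
  obtain ⟨j0, hj0⟩ : ∃ j, p.coeff j ≠ 0 := by
    by_contra h
    push Not at h
    exact hp0 (ext fun j => by simpa using h j)
  obtain ⟨i0, hi0⟩ : ∃ i, (p.coeff j0).coeff i ≠ 0 := by
    by_contra h
    push Not at h
    exact hj0 (ext fun j => by simpa using h j)
  have hyalg : IsAlgebraic ℂ y := by
    refine ⟨∑ j ∈ p.support, monomial j ((p.coeff j).coeff i0), fun h0 => hi0 ?_, ?_⟩
    · have := congrArg (fun f => coeff f j0) h0
      simpa [finsetSum_coeff, coeff_monomial, hj0] using this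
    · have := hcoeff i0
      rw [hq0, coeff_zero] at this
      rw [map_sum, this]
      refine Finset.sum_congr rfl fun j _ => ?_
      rw [aeval_monomial, mul_comm]
  have hmem := (IsAlgClosed.algebraMap_bijective_of_isIntegral (k := ℂ)
    (K := integralClosure ℂ L)).2 ⟨y, hyalg.isIntegral⟩
  obtain ⟨c, hc⟩ := hmem
  exact ⟨c, congrArg Subtype.val hc⟩

end Derivation

section Directional
open MvPolynomial

variable {d : ℕ}

/-- The directional derivative along the constant vector field `w`. -/
def ddir (w : Fin d → ℂ) : Derivation ℂ (MvPolynomial (Fin d) ℂ) (MvPolynomial (Fin d) ℂ) :=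
  ∑ k, w k • pderiv k

lemma ddir_apply (w : Fin d → ℂ) (F : MvPolynomial (Fin d) ℂ) :
    ddir w F = ∑ k, C (w k) * pderiv k F := by
  have : ddir w F = ∑ k, (w k • pderiv k : Derivation ℂ _ (MvPolynomial (Fin d) ℂ)) F := by
    rw [ddir, ← Derivation.coeFnAddMonoidHom_apply, map_sum, Finset.sum_apply]
    rfl
  simp [this, MvPolynomial.smul_eq_C_mul]

lemma ddir_linPoly (w : Fin d → ℂ) (u : (Fin d → ℂ) →ₗ[ℂ] ℂ) :
    ddir w (linPoly u) = C (u w) := by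
  rw [ddir_apply, apply_eq_sum_single u w, map_sum]
  refine Finset.sum_congr rfl fun k _ => ?_
  have : pderiv k (linPoly u) = C (u (Pi.single k 1)) := by
    simp [linPoly, Derivation.leibniz, pderiv_X, Pi.single_apply]
  rw [this, map_mul, mul_comm]

lemma isHomogeneous_ddir {F : MvPolynomial (Fin d) ℂ} {n : ℕ} (hF : F.IsHomogeneous n)
    (w : Fin d → ℂ) : (ddir w F).IsHomogeneous (n - 1) := by
  rw [ddir_apply]
  exact IsHomogeneous.sum _ _ _ fun k _ => hF.pderiv.C_mul _

/-- The derivative of `F` at `v` in direction `w`, over any `ℂ`-algebra. -/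
def dir {B : Type*} [CommRing B] [Algebra ℂ B] (F : MvPolynomial (Fin d) ℂ)
    (w v : Fin d → B) : B :=
  ∑ k, w k * aeval v (pderiv k F)

lemma dir_eq_eval_ddir (F : MvPolynomial (Fin d) ℂ) (w v : Fin d → ℂ) :
    dir F w v = eval v (ddir w F) := by
  simp [dir, ddir_apply, aeval_eq_eval]

lemma map_dir {B B' : Type*} [CommRing B] [Algebra ℂ B] [CommRing B'] [Algebra ℂ B']
    (φ : B →ₐ[ℂ] B') (F : MvPolynomial (Fin d) ℂ) (w v : Fin d → B) :
    φ (dir F w v) = dir F (fun k => φ (w k)) (fun k => φ (v k)) := by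
  simp only [dir, map_sum, map_mul]
  refine Finset.sum_congr rfl fun k _ => ?_
  rw [← MvPolynomial.comp_aeval_apply]

lemma dir_add_smul {B : Type*} [CommRing B] [Algebra ℂ B] (F : MvPolynomial (Fin d) ℂ)
    (a b : B) (w w' v : Fin d → B) :
    dir F (fun k => a * w k + b * w' k) v = a * dir F w v + b * dir F w' v := by
  simp only [dir, Finset.mul_sum, ← Finset.sum_add_distrib]
  exact Finset.sum_congr rfl fun k _ => by ring

/-- The chain rule. -/
lemma derivation_aeval {B : Type*} [CommRing B] [Algebra ℂ B] (D : Derivation ℂ B B)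
    (v : Fin d → B) (F : MvPolynomial (Fin d) ℂ) :
    D (aeval v F) = dir F (fun k => D (v k)) v := by
  induction F using MvPolynomial.induction_on with
  | C a => simp [dir]
  | add p q hp hq =>
    rw [map_add, map_add, hp, hq]
    simp [dir, mul_add, Finset.sum_add_distrib]
  | mul_X p n hp =>
    rw [map_mul, Derivation.leibniz, hp]
    simp only [dir, aeval_X, smul_eq_mul, Derivation.leibniz, map_add, map_mul, mul_add,
      Finset.sum_add_distrib, Finset.mul_sum]
    congr 1
    · simp [pderiv_X, Pi.single_apply, mul_comm]
    · exact Finset.sum_congr rfl fun k _ => by ring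

end Directional

section Equations
open MvPolynomial

variable {d : ℕ}

/-- The form of degree `2 * n` homogenising a polynomial of bidegree `(n, n)`. -/
def biform (l m y : (Fin d → ℂ) →ₗ[ℂ] ℂ) (n : ℕ) (q : Polynomial (Polynomial ℂ)) :
    MvPolynomial (Fin d) ℂ :=
  ∑ j ∈ Finset.range (n + 1), ∑ i ∈ Finset.range (n + 1),
    C ((q.coeff j).coeff i) * (linPoly l ^ (2 * n - i - j) * linPoly m ^ i * linPoly y ^ j)

lemma isHomogeneous_biform (l m y : (Fin d → ℂ) →ₗ[ℂ] ℂ) (n : ℕ)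
    (q : Polynomial (Polynomial ℂ)) : (biform l m y n q).IsHomogeneous (2 * n) := by
  refine IsHomogeneous.sum _ _ _ fun j hj => IsHomogeneous.sum _ _ _ fun i hi => ?_
  refine IsHomogeneous.C_mul ?_ _
  have := ((isHomogeneous_linPoly_pow l (2 * n - i - j)).mul (isHomogeneous_linPoly_pow m i)).mul
    (isHomogeneous_linPoly_pow y j)
  rw [Finset.mem_range] at hi hj
  rwa [show 2 * n - i - j + i + j = 2 * n by omega] at this

variable {Z : Set (Fin d → ℂ)} {l m : (Fin d → ℂ) →ₗ[ℂ] ℂ}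
  {A : Type} [CommRing A] [Algebra ℂ A] {π : MvPolynomial (Fin d) ℂ →ₐ[ℂ] A}
  [Algebra (Polynomial ℂ) A] [IsScalarTower ℂ (Polynomial ℂ) A]

lemma algebraMap_eq_sum {t : A} (ht : algebraMap (Polynomial ℂ) A Polynomial.X = t)
    {n : ℕ} {p : Polynomial ℂ} (hp : p.natDegree ≤ n) :
    algebraMap (Polynomial ℂ) A p = ∑ i ∈ Finset.range (n + 1), p.coeff i • t ^ i := by
  have : algebraMap (Polynomial ℂ) A p = Polynomial.aeval t p := by
    rw [← ht, Polynomial.aeval_algebraMap_apply, Polynomial.aeval_X_left_apply]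
  rw [this, Polynomial.aeval_eq_sum_range' (n := n + 1) (by omega)]

lemma IsAffineModel.map_biform (h : IsAffineModel Z l π)
    (ht : algebraMap (Polynomial ℂ) A Polynomial.X = π (linPoly m))
    (y : (Fin d → ℂ) →ₗ[ℂ] ℂ) {n : ℕ} {q : Polynomial (Polynomial ℂ)} (hq : q.natDegree ≤ n)
    (hq' : ∀ j, (q.coeff j).natDegree ≤ n) :
    π (biform l m y n q) = Polynomial.aeval (π (linPoly y)) q := by
  rw [Polynomial.aeval_eq_sum_range' (n := n + 1) (by omega), biform, map_sum]
  refine Finset.sum_congr rfl fun j _ => ?_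
  rw [Algebra.smul_def, algebraMap_eq_sum ht (hq' j), Finset.sum_mul, map_sum]
  refine Finset.sum_congr rfl fun i _ => ?_
  rw [map_mul, map_mul, map_mul, map_pow, map_pow, map_pow, h.map_l, one_pow, one_mul,
    Algebra.smul_def, mul_assoc]
  congr 1
  exact π.commutes _

lemma IsAffineModel.map_ddir_biform (h : IsAffineModel Z l π)
    (ht : algebraMap (Polynomial ℂ) A Polynomial.X = π (linPoly m))
    (y : (Fin d → ℂ) →ₗ[ℂ] ℂ) {n : ℕ} {q : Polynomial (Polynomial ℂ)} (hq : q.natDegree ≤ n)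
    (hq' : ∀ j, (q.coeff j).natDegree ≤ n) {w : Fin d → ℂ} (hl : l w = 0) (hm : m w = 0)
    (hy : y w = 1) :
    π (ddir w (biform l m y n q)) =
      Polynomial.aeval (π (linPoly y)) (Polynomial.derivative q) := by
  rw [Polynomial.derivative_apply, Polynomial.sum_over_range' _ (by simp) (n + 1) (by omega),
    biform, map_sum, map_sum, map_sum]
  refine Finset.sum_congr rfl fun j _ => ?_
  rw [map_mul, Polynomial.aeval_C, map_mul, algebraMap_eq_sum ht (hq' j), Finset.sum_mul,
    Finset.sum_mul, map_sum, map_sum]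
  refine Finset.sum_congr rfl fun i _ => ?_
  have hC : π (C ((q.coeff j).coeff i)) = algebraMap ℂ A ((q.coeff j).coeff i) := π.commutes _
  have hd : ddir w (C ((q.coeff j).coeff i)) = 0 := (ddir w).map_algebraMap _
  simp only [Derivation.leibniz, Derivation.leibniz_pow, ddir_linPoly, hl, hm, hy, hd, map_zero,
    map_one, smul_eq_mul, mul_zero, add_zero, mul_one, map_mul, map_pow,
    h.map_l, one_pow, one_mul, hC, eq_natCast, map_natCast, Polynomial.aeval_X,
    Algebra.smul_def]
  ring

lemma ddir_biform_eq_zero {y : (Fin d → ℂ) →ₗ[ℂ] ℂ} {w : Fin d → ℂ} (hl : l w = 0) (hm : m w = 0)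
    (hy : y w = 0) (n : ℕ) (q : Polynomial (Polynomial ℂ)) :
    ddir w (biform l m y n q) = 0 := by
  simp only [biform, map_sum, Derivation.leibniz, Derivation.leibniz_pow, ddir_linPoly, hl, hm, hy]
  simp

/-- A plane equation of bidegree at most `(2 r, 2 r)` for the projection of the curve to the
`(t, y)`-plane, where `t = m / l`. -/
lemma IsAffineModel.exists_relation [IsDomain A] [Module.Finite (Polynomial ℂ) A]
    [Module.Free (Polynomial ℂ) A] (h : IsAffineModel Z l π) (hZ : IsIrredCone Z)
    (hlm : ∀ v ∈ Z, l v = 0 → m v = 0 → v = 0)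
    (ht : algebraMap (Polynomial ℂ) A Polynomial.X = π (linPoly m))
    (hpts : ∀ N : ℕ, ∃ v : Fin N → Fin d → ℂ, ProjDistinct v ∧ ∀ i, v i ∈ Z)
    (y : (Fin d → ℂ) →ₗ[ℂ] ℂ) {n : ℕ} (hn : n = 2 * Module.finrank (Polynomial ℂ) A) :
    ∃ q : Polynomial (Polynomial ℂ), q ≠ 0 ∧ q.natDegree ≤ n ∧
      (∀ j, (q.coeff j).natDegree ≤ n) ∧ Polynomial.aeval (π (linPoly y)) q = 0 := by
  obtain ⟨v, hv, hvZ⟩ := hpts (n ^ 2 + 1)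
  have hr : 0 < Module.finrank (Polynomial ℂ) A := Module.finrank_pos
  let Φ : (Fin (n + 1) × Fin (n + 1) → ℂ) →ₗ[ℂ] (Fin (n ^ 2 + 1) → ℂ) :=
    Fintype.linearCombination ℂ fun p k =>
      l (v k) ^ (2 * n - p.2 - p.1) * m (v k) ^ (p.2 : ℕ) * y (v k) ^ (p.1 : ℕ)
  have hker : LinearMap.ker Φ ≠ ⊥ := by
    refine LinearMap.ker_ne_bot_of_finrank_lt ?_
    simp only [Module.finrank_fintype_fun_eq_card, Fintype.card_fin, Fintype.card_prod]
    nlinarith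
  obtain ⟨c, hc, hc0⟩ := Submodule.exists_mem_ne_zero_of_ne_bot hker
  obtain ⟨c', hc₁, hc₂⟩ : ∃ c' : ℕ → ℕ → ℂ, (∀ j i : Fin (n + 1), c' j i = c (j, i)) ∧
      ∀ j i, ¬ (j < n + 1 ∧ i < n + 1) → c' j i = 0 :=
    ⟨fun j i => if hji : j < n + 1 ∧ i < n + 1 then c (⟨j, hji.1⟩, ⟨i, hji.2⟩) else 0,
      fun j i => dif_pos ⟨j.2, i.2⟩, fun j i hji => dif_neg hji⟩
  let q : Polynomial (Polynomial ℂ) := ∑ j ∈ Finset.range (n + 1),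
    Polynomial.monomial j (∑ i ∈ Finset.range (n + 1), Polynomial.monomial i (c' j i))
  have hqc : ∀ j i, (q.coeff j).coeff i = c' j i := by
    intro j i
    by_cases hj : j < n + 1
    · by_cases hi : i < n + 1
      · simp [q, Polynomial.finsetSum_coeff, Polynomial.coeff_monomial, hj, hi]
      · rw [hc₂ j i (by omega)]
        simp [q, Polynomial.finsetSum_coeff, Polynomial.coeff_monomial, hj, hi]
    · rw [hc₂ j i (by omega)]
      simp [q, Polynomial.finsetSum_coeff, Polynomial.coeff_monomial, hj]
  have hdeg : q.natDegree ≤ n := by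
    refine Polynomial.natDegree_sum_le_of_forall_le _ _ fun j hj => ?_
    have := Finset.mem_range.1 hj
    exact (Polynomial.natDegree_monomial_le _).trans (by omega)
  have hdeg' : ∀ j, (q.coeff j).natDegree ≤ n := by
    intro j
    rw [Polynomial.natDegree_le_iff_coeff_eq_zero]
    intro i hi
    rw [hqc, hc₂ j i (by omega)]
  refine ⟨q, fun h0 => hc0 ?_, hdeg, hdeg', ?_⟩
  · funext ⟨j, i⟩
    have := hqc j i
    simpa [h0, hc₁] using this.symm
  · rw [← h.map_biform ht y hdeg hdeg',
      h.ker_iff _ _ (isHomogeneous_biform l m y n q)]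
    by_contra hnv
    have := h.zerosLE hZ hlm ht (isHomogeneous_biform l m y n q) hnv (n ^ 2 + 1) v hv fun k => by
      refine ⟨hvZ k, ?_⟩
      have hk := congrFun (LinearMap.mem_ker.1 hc) k
      rw [Fintype.linearCombination_apply, Fintype.sum_prod_type, Finset.sum_apply] at hk
      simp only [Finset.sum_apply, Pi.smul_apply, smul_eq_mul] at hk
      simp only [biform, map_sum, map_mul, eval_C, map_pow, eval_linPoly, hqc]
      rw [Finset.sum_range]
      simp_rw [Finset.sum_range]
      simpa only [hc₁, Pi.zero_apply] using hk
    subst hn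
    nlinarith

/-- A form vanishing on the curve that cuts out its projection to the `(t, y)`-plane generically
transversally. -/
lemma IsAffineModel.exists_equation [IsDomain A] [Module.Finite (Polynomial ℂ) A]
    [Module.Free (Polynomial ℂ) A] (h : IsAffineModel Z l π) (hZ : IsIrredCone Z)
    (hlm : ∀ v ∈ Z, l v = 0 → m v = 0 → v = 0)
    (ht : algebraMap (Polynomial ℂ) A Polynomial.X = π (linPoly m))
    (hinj : Function.Injective (algebraMap (Polynomial ℂ) A))
    (hpts : ∀ N : ℕ, ∃ v : Fin N → Fin d → ℂ, ProjDistinct v ∧ ∀ i, v i ∈ Z)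
    (y : (Fin d → ℂ) →ₗ[ℂ] ℂ) :
    ∃ F : MvPolynomial (Fin d) ℂ, F.IsHomogeneous (4 * Module.finrank (Polynomial ℂ) A) ∧
      VanishesOn Z F ∧ ∀ w, l w = 0 → m w = 0 →
        (y w = 0 → ddir w F = 0) ∧ (y w = 1 → π (ddir w F) ≠ 0) := by
  set n := 2 * Module.finrank (Polynomial ℂ) A with hn
  let S : Set (Polynomial (Polynomial ℂ)) := {q | q ≠ 0 ∧ q.natDegree ≤ n ∧
    (∀ j, (q.coeff j).natDegree ≤ n) ∧ Polynomial.aeval (π (linPoly y)) q = 0}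
  obtain ⟨q, ⟨hq0, hdeg, hdeg', hq⟩, hmin⟩ :=
    (InvImage.wf Polynomial.natDegree wellFounded_lt).has_min S
      (h.exists_relation hZ hlm ht hpts y hn)
  have hhom := isHomogeneous_biform l m y n q
  have hhom' : (biform l m y n q).IsHomogeneous (4 * Module.finrank (Polynomial ℂ) A) := by
    rwa [show 4 * Module.finrank (Polynomial ℂ) A = 2 * n by omega]
  refine ⟨biform l m y n q, hhom', (h.ker_iff _ _ hhom).1 (by rw [h.map_biform ht y hdeg hdeg', hq]),
    fun w hl hm => ⟨fun hy => ddir_biform_eq_zero hl hm hy n q, fun hy => ?_⟩⟩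
  rw [h.map_ddir_biform ht y hdeg hdeg' hl hm hy]
  intro hder
  have hdpos : q.natDegree ≠ 0 := by
    intro h0
    rw [Polynomial.eq_C_of_natDegree_eq_zero h0, Polynomial.aeval_C] at hq
    have := hinj (hq.trans (map_zero _).symm)
    rw [Polynomial.eq_C_of_natDegree_eq_zero h0, this, map_zero] at hq0
    exact hq0 rfl
  have hlt := Polynomial.natDegree_derivative_lt hdpos
  refine hmin (Polynomial.derivative q) ⟨?_, by omega, fun j => ?_, hder⟩ hlt
  · exact fun h0 => hdpos (Polynomial.derivative_eq_zero.1 h0)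
  · rw [Polynomial.coeff_derivative]
    refine (Polynomial.natDegree_mul_le).trans ?_
    have h1 := hdeg' (j + 1)
    have h2 : ((j : Polynomial ℂ) + 1).natDegree = 0 := by
      have := Polynomial.natDegree_natCast (R := ℂ) (j + 1)
      simpa using this
    omega

end Equations

section GenericRoot

/-- An ideal of `A[s]` either has a zero over every algebraically closed extension of the fraction
field of `A`, or contains a nonzero constant. -/
lemma exists_root_or_exists_C_mem {A L : Type*} [CommRing A] [IsDomain A] [Field L] [IsAlgClosed L]
    [Algebra A L] [FaithfulSMul A L] (I : Ideal (Polynomial A)) :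
    (∃ s : L, ∀ f ∈ I, Polynomial.aeval s f = 0) ∨ ∃ a : A, a ≠ 0 ∧ Polynomial.C a ∈ I := by
  let K := FractionRing A
  let _ : Algebra K L := FractionRing.liftAlgebra A L
  let ψ : Polynomial A →+* Polynomial K := Polynomial.mapRingHom (algebraMap A K)
  let _ : Algebra (Polynomial A) (Polynomial K) := ψ.toAlgebra
  have : IsLocalization ((nonZeroDivisors A).map (Polynomial.C : A →+* Polynomial A))
    (Polynomial K) := Polynomial.isLocalization _ _
  obtain ⟨g, hg⟩ := (IsPrincipalIdealRing.principal (I.map ψ)).principal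
  by_cases hdeg : g.degree = 0
  · right
    have htop : (1 : Polynomial K) ∈ I.map (algebraMap (Polynomial A) (Polynomial K)) := by
      change (1 : Polynomial K) ∈ I.map ψ
      have h1 : I.map ψ = ⊤ := by
        rw [hg]
        exact Ideal.span_singleton_eq_top.2 (Polynomial.isUnit_iff_degree_eq_zero.2 hdeg)
      rw [h1]
      exact Submodule.mem_top
    rw [IsLocalization.mem_map_algebraMap_iff
      ((nonZeroDivisors A).map (Polynomial.C : A →+* Polynomial A))] at htop
    obtain ⟨⟨f, ⟨_, a, ha, rfl⟩⟩, hf⟩ := htop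
    refine ⟨a, nonZeroDivisors.ne_zero ha, ?_⟩
    have hinj : Function.Injective ψ :=
      Polynomial.map_injective _ (IsFractionRing.injective A K)
    rw [one_mul] at hf
    have := hinj hf
    simp only at this
    rw [show Polynomial.C a = (f : Polynomial A) from this]
    exact f.2
  · left
    obtain ⟨s, hs⟩ := IsAlgClosed.exists_aeval_eq_zero L g hdeg
    refine ⟨s, fun f hf => ?_⟩
    have hf' : ψ f ∈ Submodule.span (Polynomial K) {g} := hg ▸ Ideal.mem_map_of_mem ψ hf
    obtain ⟨b, hb⟩ := Submodule.mem_span_singleton.1 hf'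
    have : Polynomial.aeval s (ψ f) = Polynomial.aeval s f :=
      Polynomial.aeval_map_algebraMap K s f
    rw [← this, ← hb, smul_eq_mul, map_mul, hs, mul_zero]

open MvPolynomial

variable {d : ℕ} {Z : Set (Fin d → ℂ)} {l m : (Fin d → ℂ) →ₗ[ℂ] ℂ}
  {A : Type} [CommRing A] [Algebra ℂ A] {π : MvPolynomial (Fin d) ℂ →ₐ[ℂ] A}

lemma eval_smul_of_isHomogeneous {f : MvPolynomial (Fin d) ℂ} {k : ℕ} (hf : f.IsHomogeneous k)
    (c : ℂ) (v : Fin d → ℂ) : eval (c • v) f = c ^ k * eval v f := by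
  rw [eval_eq, eval_eq, Finset.mul_sum]
  refine Finset.sum_congr rfl fun a ha => ?_
  have hk : ∑ i ∈ a.support, a i = k := by
    rw [← hf.degree_eq_sum_deg_support ha]
  simp only [Pi.smul_apply, smul_eq_mul, mul_pow, Finset.prod_mul_distrib, ← hk,
    Finset.prod_pow_eq_pow_sum]
  ring

lemma IsIrredCone.smul_mem (hZ : IsIrredCone Z) {v : Fin d → ℂ} (hv : v ∈ Z) (c : ℂ) :
    c • v ∈ Z := by
  refine hZ.closed _ fun f k hf hfZ => ?_
  rw [eval_smul_of_isHomogeneous hf, hfZ v hv, mul_zero]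

/-- For almost every point `p` of the curve, the line through `x` and `p` meets the curve again. -/
def IsBad (Z : Set (Fin d → ℂ)) (x : Fin d → ℂ) : Prop :=
  ∀ a k, a.IsHomogeneous k → ¬ VanishesOn Z a →
    ∃ p ∈ Z, eval p a ≠ 0 ∧ ∃ σ : ℂ, x + σ • p ∈ Z

/-- Over a large enough field, the line through a bad point and the generic point of the curve
meets the curve again. -/
lemma IsAffineModel.exists_root [IsDomain A] {L : Type*} [Field L] [IsAlgClosed L]
    [Algebra ℂ L] [Algebra A L] [IsScalarTower ℂ A L] [FaithfulSMul A L]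
    (h : IsAffineModel Z l π) (hZ : IsIrredCone Z) {x : Fin d → ℂ} (hx : IsBad Z x) :
    ∃ s : L, ∀ f k, f.IsHomogeneous k → VanishesOn Z f →
      aeval (fun i => algebraMap ℂ L (x i) + s * algebraMap A L (π (X i))) f = 0 := by
  let ψ : MvPolynomial (Fin d) ℂ →ₐ[ℂ] Polynomial A :=
    aeval fun i => algebraMap ℂ (Polynomial A) (x i) + Polynomial.X * Polynomial.C (π (X i))
  let S : Set (Polynomial A) := {g | ∃ f k, f.IsHomogeneous k ∧ VanishesOn Z f ∧ ψ f = g}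
  rcases exists_root_or_exists_C_mem (L := L) (Ideal.span S) with ⟨s, hs⟩ | ⟨a, ha, haS⟩
  · refine ⟨s, fun f k hf hfZ => ?_⟩
    have := hs (ψ f) (Ideal.subset_span ⟨f, k, hf, hfZ, rfl⟩)
    let χ : Polynomial A →ₐ[ℂ] L := (Polynomial.aeval s : Polynomial A →ₐ[A] L).restrictScalars ℂ
    have h2 : χ (ψ f) = 0 := this
    simp only [ψ] at h2
    rw [comp_aeval_apply] at h2
    rw [← h2]
    congr 2
    funext i
    simp [χ, IsScalarTower.algebraMap_apply ℂ A L]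
    ring
  · exfalso
    obtain ⟨f₀, rfl⟩ := h.surj a
    obtain ⟨F, hF, hFf⟩ := h.exists_form f₀ le_rfl
    have hF' : ¬ VanishesOn Z (F * linPoly l) := by
      rw [← h.ker_iff _ _ (hF.mul (isHomogeneous_linPoly l)), map_mul, h.map_l, mul_one, hFf]
      exact ha
    obtain ⟨p, hp, hpF, σ, hσ⟩ := hx _ _ (hF.mul (isHomogeneous_linPoly l)) hF'
    rw [map_mul, eval_linPoly] at hpF
    have hlp : l p ≠ 0 := right_ne_zero_of_mul hpF
    have hFp := left_ne_zero_of_mul hpF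
    let p' := (l p)⁻¹ • p
    have hp' : p' ∈ Z := hZ.smul_mem hp _
    have hlp' : l p' = 1 := by simp [p', hlp]
    let ev : A →ₐ[ℂ] ℂ := AlgHom.liftOfSurjective π h.surj (aeval p')
      fun f hf => by
        have := h.eval_eq_zero p' hp' hlp' f hf
        rwa [← aeval_eq_eval] at this
    have hev : ∀ f, ev (π f) = eval p' f := fun f => by
      rw [← aeval_eq_eval]
      exact AlgHom.liftOfSurjective_apply ..
    let φ : Polynomial A →+* ℂ := Polynomial.eval₂RingHom (ev : A →+* ℂ) (σ * l p)
    have hφS : Ideal.span S ≤ RingHom.ker φ := by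
      rw [Ideal.span_le]
      rintro _ ⟨f, k, hf, hfZ, rfl⟩
      have h1 : φ (ψ f) = eval (x + σ • p) f := by
        let χ : Polynomial A →ₐ[ℂ] ℂ :=
          { φ with
            commutes' := fun c => by
              simp [φ, IsScalarTower.algebraMap_apply ℂ A (Polynomial A)] }
        change χ (ψ f) = _
        simp only [ψ]
        rw [comp_aeval_apply, ← aeval_eq_eval]
        congr 2
        funext i
        change φ _ = _
        simp [φ, IsScalarTower.algebraMap_apply ℂ A (Polynomial A), hev, p']
        field_simp
      exact h1.trans (hfZ _ hσ)
    have h0 : eval p' f₀ = 0 := by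
      have := hφS haS
      rw [RingHom.mem_ker] at this
      simpa [φ, hev] using this
    have : ev (π F) = 0 := by rw [hFf, hev, h0]
    rw [hev, eval_smul_of_isHomogeneous hF] at this
    exact mul_ne_zero (pow_ne_zero _ (inv_ne_zero hlp)) hFp this

end GenericRoot

section Wronskian
open MvPolynomial

variable {d : ℕ}

/-- A space of dimension at least four contains two directions killed by two given functionals,
together with dual functionals. -/
lemma exists_directions (E : Submodule ℂ (Fin d → ℂ)) (hE : 4 ≤ Module.finrank ℂ E)
    (l m : (Fin d → ℂ) →ₗ[ℂ] ℂ) :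
    ∃ (a b : Fin d → ℂ) (y z : (Fin d → ℂ) →ₗ[ℂ] ℂ), (a ∈ E ∧ l a = 0 ∧ m a = 0) ∧
      (b ∈ E ∧ l b = 0 ∧ m b = 0) ∧ y a = 1 ∧ y b = 0 ∧ z a = 0 ∧ z b = 1 := by
  obtain ⟨v, hv, hmem⟩ : ∃ v : Fin 2 → Fin d → ℂ, LinearIndependent ℂ v ∧
      ∀ i, v i ∈ E ∧ l (v i) = 0 ∧ m (v i) = 0 := by
    have h1 := Submodule.finrank_sup_add_finrank_inf_eq E (LinearMap.ker (l.prod m))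
    have h2 := (l.prod m).finrank_range_add_finrank_ker
    have h3 : Module.finrank ℂ (LinearMap.range (l.prod m)) ≤ 2 := by
      simpa using Submodule.finrank_le (LinearMap.range (l.prod m))
    have h4 := Submodule.finrank_le (E ⊔ LinearMap.ker (l.prod m))
    have h5 : 2 ≤ Module.finrank ℂ
        (E ⊓ LinearMap.ker (l.prod m) : Submodule ℂ (Fin d → ℂ)) := by omega
    obtain ⟨f, hf⟩ := exists_linearIndependent_of_le_finrank h5
    exact ⟨fun i => f i, hf.map' (Submodule.subtype _) (Submodule.ker_subtype _),
      fun i => ⟨(f i).2.1, Prod.ext_iff.1 (LinearMap.mem_ker.1 (f i).2.2)⟩⟩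
  have hdual : ∀ i j : Fin 2, i ≠ j → ∃ y : (Fin d → ℂ) →ₗ[ℂ] ℂ, y (v i) = 1 ∧ y (v j) = 0 := by
    intro i j hij
    obtain ⟨u, hu, hu'⟩ := exists_functional_separating (v := v i) (w := v j) fun c hc => by
      have := hv.notMem_span_image (s := {j}) (x := i) (by simpa using hij)
      rw [Set.image_singleton, Submodule.mem_span_singleton] at this
      exact this ⟨c, hc.symm⟩
    exact ⟨(u (v i))⁻¹ • u, by simp [hu'], by simp [hu]⟩
  obtain ⟨y, hy, hy'⟩ := hdual 0 1 (by decide)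
  obtain ⟨z, hz, hz'⟩ := hdual 1 0 (by decide)
  exact ⟨v 0, v 1, y, z, hmem 0, hmem 1, hy, hy', hz', hz⟩

/-- The linear form `w ↦ dir F w c`. -/
def dirFun (F : MvPolynomial (Fin d) ℂ) (c : Fin d → ℂ) : (Fin d → ℂ) →ₗ[ℂ] ℂ where
  toFun w := dir F w c
  map_add' w w' := by simp [dir, add_mul, Finset.sum_add_distrib]
  map_smul' a w := by simp [dir, mul_assoc, Finset.mul_sum]

lemma dir_algebraMap {B : Type*} [CommRing B] [Algebra ℂ B] (F : MvPolynomial (Fin d) ℂ)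
    (w : Fin d → B) (c : Fin d → ℂ) :
    dir F w (fun k => algebraMap ℂ B (c k)) = aeval w (linPoly (dirFun F c)) := by
  rw [aeval_linPoly, dir]
  refine Finset.sum_congr rfl fun k _ => ?_
  have : dirFun F c (Pi.single k 1) = aeval c (pderiv k F) := by
    simp [dirFun, dir, Pi.single_apply]
  rw [this, Algebra.smul_def, mul_comm, ← aeval_algebraMap_apply]
  rfl

/-- The Jacobian determinant of `F` and `G` at `q` along the directions `p` and `p'`. -/
def jac {B : Type*} [CommRing B] [Algebra ℂ B] (F G : MvPolynomial (Fin d) ℂ)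
    (p p' q : Fin d → B) : B :=
  dir F p q * dir G p' q - dir F p' q * dir G p q

lemma map_jac {B B' : Type*} [CommRing B] [Algebra ℂ B] [CommRing B'] [Algebra ℂ B']
    (φ : B →ₐ[ℂ] B') (F G : MvPolynomial (Fin d) ℂ) (p p' q : Fin d → B) :
    φ (jac F G p p' q) =
      jac F G (fun k => φ (p k)) (fun k => φ (p' k)) (fun k => φ (q k)) := by
  simp only [jac, map_sub, map_mul, map_dir]

/-- If a curve `x + s P` lies on `F = G = 0`, then the Jacobian of `F` and `G` along `P` and its
derivative vanishes. -/
lemma jac_eq_zero {L : Type*} [Field L] [Algebra ℂ L] (D : Derivation ℂ L L)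
    {F G : MvPolynomial (Fin d) ℂ} (x : Fin d → ℂ) (P : Fin d → L) {s : L} (hs : s ≠ 0)
    (hF : aeval (fun i => algebraMap ℂ L (x i) + s * P i) F = 0)
    (hG : aeval (fun i => algebraMap ℂ L (x i) + s * P i) G = 0) :
    jac F G P (fun k => D (P k)) (fun i => algebraMap ℂ L (x i) + s * P i) = 0 := by
  have hD : (fun k => D (algebraMap ℂ L (x k) + s * P k)) =
      fun k => D s * P k + s * D (P k) := by
    funext k
    simp [Derivation.leibniz]
    ring
  have key : ∀ H : MvPolynomial (Fin d) ℂ,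
      aeval (fun i => algebraMap ℂ L (x i) + s * P i) H = 0 →
      D s * dir H P (fun i => algebraMap ℂ L (x i) + s * P i) +
        s * dir H (fun k => D (P k)) (fun i => algebraMap ℂ L (x i) + s * P i) = 0 := by
    intro H hH
    rw [← dir_add_smul, ← hD, ← derivation_aeval, hH, map_zero]
  refine (mul_eq_zero.1 (?_ : s * _ = 0)).resolve_left hs
  rw [jac]
  linear_combination dir F P (fun i => algebraMap ℂ L (x i) + s * P i) * key G hG -
    dir G P (fun i => algebraMap ℂ L (x i) + s * P i) * key F hF

lemma jac_algebraMap_ne_zero {L : Type*} [Field L] [Algebra ℂ L] (D : Derivation ℂ L L)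
    (hD : ∀ y, D y = 0 → y ∈ Set.range (algebraMap ℂ L))
    {F G : MvPolynomial (Fin d) ℂ} (c : Fin d → ℂ) (P : Fin d → L)
    (hF : aeval P (linPoly (dirFun F c)) ≠ 0)
    (hG : ∀ κ : ℂ, aeval P (linPoly (dirFun G c - κ • dirFun F c)) ≠ 0) :
    jac F G P (fun k => D (P k)) (fun k => algebraMap ℂ L (c k)) ≠ 0 := by
  have hDl : ∀ u : (Fin d → ℂ) →ₗ[ℂ] ℂ,
      aeval (fun k => D (P k)) (linPoly u) = D (aeval P (linPoly u)) := by
    intro u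
    simp [aeval_linPoly]
  rw [jac, dir_algebraMap, dir_algebraMap, dir_algebraMap, dir_algebraMap, hDl, hDl]
  set a := aeval P (linPoly (dirFun F c)) with ha
  set b := aeval P (linPoly (dirFun G c)) with hb
  intro h0
  obtain ⟨κ, hκ⟩ := hD (b / a) (by
    rw [Derivation.leibniz_div]
    simp only [smul_eq_mul]
    rw [show a * D b - b * D a = 0 by linear_combination h0, mul_zero])
  refine hG κ ?_
  rw [sub_eq_add_neg, ← neg_smul, linPoly_add, linPoly_smul, map_add, map_mul, ← ha, ← hb,
    aeval_C, map_neg, hκ]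
  field_simp
  ring

end Wronskian

section Bound
open MvPolynomial

variable {d : ℕ} {Z : Set (Fin d → ℂ)} {l m : (Fin d → ℂ) →ₗ[ℂ] ℂ}
  {A : Type} [CommRing A] [Algebra ℂ A] {π : MvPolynomial (Fin d) ℂ →ₐ[ℂ] A}

/-- Specialising the generic point, lines through finitely many points joined to a common point. -/
lemma exists_common_point {L : Type*} [Field L] [Algebra ℂ L] (hZ : IsIrredCone Z)
    {F G : MvPolynomial (Fin d) ℂ} {N : ℕ} (x : Fin N → Fin d → ℂ) (P P' : Fin d → L)
    (s : Fin N → L)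
    (hs : ∀ i f k, f.IsHomogeneous k → VanishesOn Z f →
      aeval (fun k => algebraMap ℂ L (x i k) + s i * P k) f = 0)
    (hjac : ∀ i, jac F G P P' (fun k => algebraMap ℂ L (x i k) + s i * P k) = 0)
    (c : Fin d → ℂ) (hc : jac F G P P' (fun k => algebraMap ℂ L (c k)) ≠ 0)
    (u : Fin N → Fin N → (Fin d → ℂ) →ₗ[ℂ] ℂ) (hu : ∀ i j, aeval P (linPoly (u i j)) ≠ 0) :
    ∃ (p p' : Fin d → ℂ) (t : Fin N → ℂ), (∀ i, x i + t i • p ∈ Z) ∧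
      (∀ i, jac F G p p' (x i + t i • p) = 0) ∧ jac F G p p' c ≠ 0 ∧ ∀ i j, u i j p ≠ 0 := by
  let p : Fin d → MvPolynomial (Fin d ⊕ Fin d ⊕ Fin N) ℂ := fun k => X (.inl k)
  let p' : Fin d → MvPolynomial (Fin d ⊕ Fin d ⊕ Fin N) ℂ := fun k => X (.inr (.inl k))
  let q : Fin N → Fin d → MvPolynomial (Fin d ⊕ Fin d ⊕ Fin N) ℂ := fun i k =>
    C (x i k) + X (.inr (.inr i)) * p k
  let z : Fin d ⊕ Fin d ⊕ Fin N → L := Sum.elim P (Sum.elim P' s)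
  let H : MvPolynomial (Fin d ⊕ Fin d ⊕ Fin N) ℂ := (∏ i, ∏ j, aeval p (linPoly (u i j))) *
    jac F G p p' (fun k => C (c k))
  have hzp : (fun k => aeval z (p k)) = P := by funext k; simp [p, z]
  have hzp' : (fun k => aeval z (p' k)) = P' := by funext k; simp [p', z]
  have hzq : ∀ i, (fun k => aeval z (q i k)) =
      fun k => algebraMap ℂ L (x i k) + s i * P k := by
    intro i; funext k; simp [q, p, z]
  have hH : aeval z H ≠ 0 := by
    rw [map_mul, map_jac, map_prod, hzp, hzp']
    refine mul_ne_zero (Finset.prod_ne_zero_iff.2 fun i _ => ?_) (by simpa using hc)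
    rw [map_prod]
    refine Finset.prod_ne_zero_iff.2 fun j _ => ?_
    rw [comp_aeval_apply, hzp]
    exact hu i j
  obtain ⟨v, hv, hvH⟩ := exists_specialization z H hH
  have hva : ∀ b, eval v b = aeval v b := fun b => by rw [aeval_eq_eval]
  have hvq : ∀ i, (fun k => aeval v (q i k)) =
      x i + v (.inr (.inr i)) • fun k => v (.inl k) := by
    intro i; funext k; simp [q, p]
  have hvp : (fun k => aeval v (p k)) = fun k => v (.inl k) := by funext k; simp [p]
  have hvp' : (fun k => aeval v (p' k)) = fun k => v (.inr (.inl k)) := by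
    funext k; simp [p']
  rw [hva, map_mul, map_jac, map_prod, hvp, hvp'] at hvH
  refine ⟨fun k => v (.inl k), fun k => v (.inr (.inl k)), fun i => v (.inr (.inr i)),
    fun i => ?_, fun i => ?_, ?_, fun i j => ?_⟩
  · refine hZ.closed _ fun f k hf hfZ => ?_
    have := hv (aeval (q i) f) (by rw [comp_aeval_apply, hzq]; exact hs i f k hf hfZ)
    rwa [hva, comp_aeval_apply, hvq, aeval_eq_eval] at this
  · have := hv (jac F G p p' (q i)) (by rw [map_jac, hzp, hzp', hzq]; exact hjac i)
    rwa [hva, map_jac, hvp, hvp', hvq] at this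
  · simpa using right_ne_zero_of_mul hvH
  · have h1 := Finset.prod_ne_zero_iff.1 (left_ne_zero_of_mul hvH) i (Finset.mem_univ _)
    rw [map_prod] at h1
    have h2 := Finset.prod_ne_zero_iff.1 h1 j (Finset.mem_univ _)
    rw [comp_aeval_apply, hvp, aeval_eq_eval] at h2
    simpa using h2

lemma isHomogeneous_jac {F G : MvPolynomial (Fin d) ℂ} {k : ℕ} (hF : F.IsHomogeneous k)
    (hG : G.IsHomogeneous k) (p p' : Fin d → ℂ) :
    (ddir p F * ddir p' G - ddir p' F * ddir p G).IsHomogeneous (2 * (k - 1)) := by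
  rw [two_mul]
  exact ((isHomogeneous_ddir hF _).mul (isHomogeneous_ddir hG _)).sub
    ((isHomogeneous_ddir hF _).mul (isHomogeneous_ddir hG _))

lemma eval_jac (F G : MvPolynomial (Fin d) ℂ) (p p' q : Fin d → ℂ) :
    eval q (ddir p F * ddir p' G - ddir p' F * ddir p G) = jac F G p p' q := by
  simp [jac, dir_eq_eval_ddir]

variable [Algebra (Polynomial ℂ) A] [IsScalarTower ℂ (Polynomial ℂ) A]

/-- The number of bad points off a nonplanar irreducible curve is at most quadratic in the
degree. -/
theorem IsAffineModel.card_bad_le [IsDomain A] [Module.Finite (Polynomial ℂ) A]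
    [Module.Free (Polynomial ℂ) A] (h : IsAffineModel Z l π) (hZ : IsIrredCone Z)
    (hlm : ∀ v ∈ Z, l v = 0 → m v = 0 → v = 0)
    (ht : algebraMap (Polynomial ℂ) A Polynomial.X = π (linPoly m))
    (hinj : Function.Injective (algebraMap (Polynomial ℂ) A))
    (hpts : ∀ N : ℕ, ∃ v : Fin N → Fin d → ℂ, ProjDistinct v ∧ ∀ i, v i ∈ Z)
    (hE : ∀ W : Submodule ℂ (Fin d → ℂ), Module.finrank ℂ W ≤ 3 → ¬ Z ⊆ W)
    {N : ℕ} (x : Fin N → Fin d → ℂ) (hx : ProjDistinct x) (hxZ : ∀ i, x i ∉ Z)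
    (hbad : ∀ i, IsBad Z (x i)) :
    N ≤ Module.finrank (Polynomial ℂ) A * (2 * (4 * Module.finrank (Polynomial ℂ) A - 1)) := by
  let K := FractionRing A
  let L := AlgebraicClosure K
  have : Algebra.IsAlgebraic (Polynomial ℂ) A := inferInstance
  have : Algebra.IsAlgebraic A L :=
    (IsFractionRing.comap_isAlgebraic_iff (K := K)).2 inferInstance
  have : FaithfulSMul (Polynomial ℂ) A :=
    (faithfulSMul_iff_algebraMap_injective _ _).2 hinj
  have : IsScalarTower ℂ (Polynomial ℂ) L := inferInstance
  have : IsScalarTower (Polynomial ℂ) A L := inferInstance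
  have : IsScalarTower ℂ A L := inferInstance
  have : FaithfulSMul A L := FaithfulSMul.trans A K L
  have : Algebra.IsAlgebraic (Polynomial ℂ) L := Algebra.IsAlgebraic.trans (Polynomial ℂ) A L
  have hAL : Function.Injective (algebraMap A L) := FaithfulSMul.algebraMap_injective A L
  have hinjL : Function.Injective (algebraMap (Polynomial ℂ) L) := by
    rw [IsScalarTower.algebraMap_eq (Polynomial ℂ) A L]
    exact hAL.comp hinj
  obtain ⟨D, -, hD⟩ := exists_derivation L hinjL
  have hsp : 4 ≤ Module.finrank ℂ (Submodule.span ℂ Z) := by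
    by_contra hlt
    exact hE (Submodule.span ℂ Z) (by omega) Submodule.subset_span
  have hspan : ∀ (u : (Fin d → ℂ) →ₗ[ℂ] ℂ), VanishesOn Z (linPoly u) →
      ∀ w ∈ Submodule.span ℂ Z, u w = 0 := by
    intro u hu w hw
    have : Submodule.span ℂ Z ≤ LinearMap.ker u :=
      Submodule.span_le.2 fun v hv => by simpa using hu v hv
    exact this hw
  obtain ⟨a, b, y, z, ⟨haE, hla, hma⟩, ⟨hbE, hlb, hmb⟩, hya, hyb, hza, hzb⟩ :=
    exists_directions _ hsp l m
  obtain ⟨F, hF, hFZ, hFd⟩ := h.exists_equation hZ hlm ht hinj hpts y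
  obtain ⟨G, hG, hGZ, hGd⟩ := h.exists_equation hZ hlm ht hinj hpts z
  obtain ⟨c, hcZ, hc⟩ : ∃ c ∈ Z, eval c (ddir a F * ddir b G) ≠ 0 := by
    have h1 := (h.ker_iff _ _ ((isHomogeneous_ddir hF a).mul (isHomogeneous_ddir hG b))).not.1
      (by
        rw [map_mul]
        exact mul_ne_zero ((hFd a hla hma).2 hya) ((hGd b hlb hmb).2 hzb))
    simpa [VanishesOn] using h1
  rw [map_mul] at hc
  let P : Fin d → L := fun k => algebraMap A L (π (X k))
  have hP : ∀ u : (Fin d → ℂ) →ₗ[ℂ] ℂ, aeval P (linPoly u) = 0 → VanishesOn Z (linPoly u) := by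
    intro u hu
    rw [← h.ker_iff _ _ (isHomogeneous_linPoly u)]
    refine hAL ?_
    rw [map_zero, ← hu, aeval_linPoly, linPoly]
    simp only [P, map_sum, map_mul, Algebra.smul_def]
    refine Finset.sum_congr rfl fun k _ => ?_
    congr 1
    rw [IsScalarTower.algebraMap_apply ℂ A L]
    exact congrArg _ (π.commutes _)
  have hjacc := jac_algebraMap_ne_zero D hD (F := F) (G := G) c P
    (fun h0 => left_ne_zero_of_mul hc (by
      rw [← dir_eq_eval_ddir]
      exact hspan _ (hP _ h0) a haE))
    (fun κ h0 => right_ne_zero_of_mul hc (by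
      have h1 := hspan _ (hP _ h0) b hbE
      have h2 : dirFun F c b = 0 := by
        change dir F b c = 0
        rw [dir_eq_eval_ddir, (hFd b hlb hmb).1 hyb, map_zero]
      rw [LinearMap.sub_apply, LinearMap.smul_apply, h2, smul_zero, sub_zero] at h1
      rw [← dir_eq_eval_ddir]
      exact h1))
  choose s hs using fun i => h.exists_root (L := L) hZ (hbad i)
  have hs0 : ∀ i, s i ≠ 0 := by
    intro i hi
    refine hxZ i (hZ.closed _ fun f k hf hfZ => ?_)
    have := hs i f k hf hfZ
    simp only [hi, zero_mul, add_zero] at this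
    have h2 : aeval (fun k => algebraMap ℂ L (x i k)) f = algebraMap ℂ L (aeval (x i) f) :=
      aeval_algebraMap_apply L (x i) f
    rw [h2, aeval_eq_eval] at this
    exact (algebraMap ℂ L).injective (this.trans (map_zero _).symm)
  have hu : ∀ i j, ∃ u : (Fin d → ℂ) →ₗ[ℂ] ℂ, u (x i) = 0 ∧ u (x j) = 0 ∧
      ¬ VanishesOn Z (linPoly u) := by
    intro i j
    have hfr : Module.finrank ℂ (Submodule.span ℂ (Set.range ![x i, x j])) ≤ 3 := by
      have h1 := finrank_range_le_card (R := ℂ) ![x i, x j]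
      rw [Fintype.card_fin, Set.finrank] at h1
      omega
    obtain ⟨v, hv, hvW⟩ := Set.not_subset.1 (hE _ hfr)
    obtain ⟨u, hu, huW⟩ := Submodule.exists_le_ker_of_notMem hvW
    exact ⟨u, huW (Submodule.subset_span (by simp)), huW (Submodule.subset_span (by simp)),
      fun h0 => hu (by simpa using h0 v hv)⟩
  choose u hui huj huZ using hu
  obtain ⟨p, p', t, htZ, htj, htc, hup⟩ := exists_common_point hZ x P (fun k => D (P k)) s hs
    (fun i => jac_eq_zero D (x i) P (hs0 i) (hs i F _ hF hFZ) (hs i G _ hG hGZ)) c hjacc u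
    fun i j h0 => huZ i j (hP _ h0)
  refine h.zerosLE hZ hlm ht (isHomogeneous_jac hF hG p p') (fun h0 => htc ?_) N
    (fun i => x i + t i • p) ⟨fun i hi => ?_, fun i j hij κ hκ => ?_⟩
    fun i => ⟨htZ i, by rw [eval_jac]; exact htj i⟩
  · rw [← eval_jac]
    exact h0 c hcZ
  · have h1 := congrArg (u i i) hi
    simp only [map_add, map_smul, hui, smul_eq_mul, zero_add, map_zero, mul_eq_zero, hup,
      or_false] at h1
    exact hx.1 i (by simpa [h1] using hi)
  · have h1 := congrArg (u i j) hκ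
    simp only [map_add, map_smul, hui, huj, smul_eq_mul, zero_add] at h1
    have h2 : t i = κ * t j := mul_right_cancel₀ (hup i j) (by rw [h1]; ring)
    refine hx.2 i j hij κ ?_
    replace hκ : x i + t i • p = κ • (x j + t j • p) := hκ
    rw [h2, smul_add, smul_smul] at hκ
    exact add_right_cancel hκ

end Bound

section Model
open MvPolynomial

variable {d : ℕ} {Z : Set (Fin d → ℂ)} {l m : (Fin d → ℂ) →ₗ[ℂ] ℂ}

lemma exists_homogenization (l : (Fin d → ℂ) →ₗ[ℂ] ℂ) (f : MvPolynomial (Fin d) ℂ) :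
    ∃ F k, F.IsHomogeneous k ∧ ∀ p, l p = 1 → eval p F = eval p f := by
  refine ⟨∑ i ∈ Finset.range (f.totalDegree + 1),
    homogeneousComponent i f * linPoly l ^ (f.totalDegree - i), f.totalDegree, ?_, ?_⟩
  · refine IsHomogeneous.sum _ _ _ fun i hi => ?_
    have := (homogeneousComponent_isHomogeneous i f).mul
      (isHomogeneous_linPoly_pow l (f.totalDegree - i))
    rwa [Nat.add_sub_cancel' (Nat.lt_succ_iff.1 (Finset.mem_range.1 hi))] at this
  · intro p hp
    conv_rhs => rw [← sum_homogeneousComponent f, map_sum]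
    simp [hp]

/-- The ideal of the affine part `l = 1` of `Z`. -/
abbrev affineIdeal (Z : Set (Fin d → ℂ)) (l : (Fin d → ℂ) →ₗ[ℂ] ℂ) :
    Ideal (MvPolynomial (Fin d) ℂ) :=
  vanishingIdeal ℂ {v | v ∈ Z ∧ l v = 1}

lemma mem_affineIdeal {f : MvPolynomial (Fin d) ℂ} :
    f ∈ affineIdeal Z l ↔ ∀ v ∈ Z, l v = 1 → eval v f = 0 := by
  simp [mem_vanishingIdeal_iff, aeval_eq_eval]

lemma IsIrredCone.vanishesOn_linPoly_mul (hZ : IsIrredCone Z) {f : MvPolynomial (Fin d) ℂ} {k : ℕ}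
    (hf : f.IsHomogeneous k) (h : ∀ v ∈ Z, l v = 1 → eval v f = 0) :
    VanishesOn Z (linPoly l * f) := by
  intro v hv
  rw [map_mul, eval_linPoly]
  by_cases hlv : l v = 0
  · rw [hlv, zero_mul]
  · have h1 := h ((l v)⁻¹ • v) (hZ.smul_mem hv _) (by simp [hlv])
    rw [eval_smul_of_isHomogeneous hf] at h1
    rw [(mul_eq_zero.1 h1).resolve_left (pow_ne_zero _ (inv_ne_zero hlv)), mul_zero]

lemma IsIrredCone.isPrime_affineIdeal (hZ : IsIrredCone Z) (hl : ∃ v ∈ Z, l v ≠ 0) :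
    (affineIdeal Z l).IsPrime := by
  obtain ⟨v, hv, hlv⟩ := hl
  refine ⟨fun htop => ?_, fun {f g} hfg => ?_⟩
  · have := mem_affineIdeal.1 (htop ▸ Submodule.mem_top : (1 : MvPolynomial (Fin d) ℂ) ∈ _)
      ((l v)⁻¹ • v) (hZ.smul_mem hv _) (by simp [hlv])
    simp at this
  · obtain ⟨F, i, hF, hFf⟩ := exists_homogenization l f
    obtain ⟨G, j, hG, hGg⟩ := exists_homogenization l g
    have h1 := hZ.vanishesOn_linPoly_mul (l := l) (hF.mul hG) fun p hp hlp => by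
      rw [map_mul, hFf p hlp, hGg p hlp, ← map_mul]
      exact mem_affineIdeal.1 hfg p hp hlp
    rw [← mul_assoc] at h1
    rcases hZ.irred _ _ _ _ ((isHomogeneous_linPoly l).mul hF) hG h1 with h2 | h2
    · refine Or.inl (mem_affineIdeal.2 fun p hp hlp => ?_)
      have := h2 p hp
      rwa [map_mul, eval_linPoly, hlp, one_mul, hFf p hlp] at this
    · exact Or.inr (mem_affineIdeal.2 fun p hp hlp => by rw [← hGg p hlp, h2 p hp])

lemma IsIrredCone.isAffineModel (hZ : IsIrredCone Z) (hl : ∃ v ∈ Z, l v ≠ 0) :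
    IsAffineModel Z l (Ideal.Quotient.mkₐ ℂ (affineIdeal Z l)) where
  surj := Ideal.Quotient.mkₐ_surjective ℂ _
  ker_iff f k hf := by
    rw [Ideal.Quotient.mkₐ_eq_mk, Ideal.Quotient.eq_zero_iff_mem, mem_affineIdeal]
    refine ⟨fun h => ?_, fun h v hv _ => h v hv⟩
    refine (hZ.irred _ _ _ _ (isHomogeneous_linPoly l) hf
      (hZ.vanishesOn_linPoly_mul hf h)).resolve_left fun h0 => ?_
    obtain ⟨v, hv, hlv⟩ := hl
    exact hlv (by simpa using h0 v hv)
  map_l := by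
    rw [← map_one (Ideal.Quotient.mkₐ ℂ (affineIdeal Z l)), Ideal.Quotient.mkₐ_eq_mk,
      Ideal.Quotient.mk_eq_mk_iff_sub_mem, mem_affineIdeal]
    intro v _ hlv
    simp [hlv]
  eval_eq_zero p hp hlp f hf := by
    rw [Ideal.Quotient.mkₐ_eq_mk, Ideal.Quotient.eq_zero_iff_mem, mem_affineIdeal] at hf
    exact hf p hp hlp

/-- The degree `r` of the curve: some hyperplane section has at least `r` points, Bezout's bound
holds, and it controls the number of bad points. -/
theorem IsIrredCone.exists_degree (hZ : IsIrredCone Z) (hl : ∃ v ∈ Z, l v ≠ 0)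
    (hlm : ∀ v ∈ Z, l v = 0 → m v = 0 → v = 0)
    (hpts : ∀ N : ℕ, ∃ v : Fin N → Fin d → ℂ, ProjDistinct v ∧ ∀ i, v i ∈ Z)
    (hE : ∀ W : Submodule ℂ (Fin d → ℂ), Module.finrank ℂ W ≤ 3 → ¬ Z ⊆ W) :
    ∃ r : ℕ, (∃ (u : (Fin d → ℂ) →ₗ[ℂ] ℂ) (v : Fin r → Fin d → ℂ),
        ¬ VanishesOn Z (linPoly u) ∧ ProjDistinct v ∧ ∀ i, v i ∈ Z ∧ u (v i) = 0) ∧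
      (∀ g j, g.IsHomogeneous j → ¬ VanishesOn Z g → ZerosLE Z g (r * j)) ∧
      ∀ (N : ℕ) (x : Fin N → Fin d → ℂ), ProjDistinct x → (∀ i, x i ∉ Z) →
        (∀ i, IsBad Z (x i)) → N ≤ r * (2 * (4 * r - 1)) := by
  let A := MvPolynomial (Fin d) ℂ ⧸ affineIdeal Z l
  have := hZ.isPrime_affineIdeal hl
  have : IsDomain A := Ideal.Quotient.isDomain _
  let π : MvPolynomial (Fin d) ℂ →ₐ[ℂ] A := Ideal.Quotient.mkₐ ℂ (affineIdeal Z l)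
  have h : IsAffineModel Z l π := hZ.isAffineModel hl
  let _ : Algebra (Polynomial ℂ) A :=
    (Polynomial.aeval (π (linPoly m)) : Polynomial ℂ →ₐ[ℂ] A).toRingHom.toAlgebra
  have : IsScalarTower ℂ (Polynomial ℂ) A := IsScalarTower.of_algebraMap_eq fun c =>
    ((Polynomial.aeval (π (linPoly m)) : Polynomial ℂ →ₐ[ℂ] A).commutes c).symm
  have ht : algebraMap (Polynomial ℂ) A Polynomial.X = π (linPoly m) := Polynomial.aeval_X _
  have hfin := h.module_finite hZ hlm ht
  have hinj : Function.Injective (algebraMap (Polynomial ℂ) A) := by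
    obtain ⟨v, hv, hvZ⟩ := hpts 2
    exact h.algebraMap_injective hZ hlm ht
      ⟨v 0, hvZ 0, v 1, hvZ 1, hv.1 1, hv.2 0 1 (by decide)⟩
  have : FaithfulSMul (Polynomial ℂ) A := (faithfulSMul_iff_algebraMap_injective _ _).2 hinj
  have : Module.Free (Polynomial ℂ) A := Module.free_of_finite_type_torsion_free'
  refine ⟨Module.finrank (Polynomial ℂ) A, ?_, fun g j hg hgZ => h.zerosLE hZ hlm ht hg hgZ,
    fun N x hx hxZ hbad => h.card_bad_le hZ hlm ht hinj hpts hE x hx hxZ hbad⟩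
  obtain ⟨c, v, hv, hvZ⟩ := h.exists_section hZ hinj ht
  refine ⟨m - c • l, v, ?_, hv, hvZ⟩
  rw [← h.ker_iff _ _ (isHomogeneous_linPoly _)]
  intro h0
  refine Polynomial.X_sub_C_ne_zero c (hinj ?_)
  rw [map_zero, ← h0, sub_eq_add_neg, sub_eq_add_neg, ← neg_smul, linPoly_add, linPoly_smul,
    map_add, map_add, map_mul, h.map_l, mul_one, ht, map_neg]
  congr 1
  rw [map_neg, map_neg]
  congr 1
  exact (IsScalarTower.algebraMap_apply ℂ (Polynomial ℂ) A c).symm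

end Model

section Projective
open MvPolynomial

variable {n : ℕ} {δ : Set (PS ℂ n)}

lemma mem_submodule_iff {x : PS ℂ n} {v : Fin (n + 1) → ℂ} :
    v ∈ x.submodule ↔ ∃ c : ℂ, c • x.rep = v := by
  rw [Projectivization.submodule_eq, Submodule.mem_span_singleton]

lemma rep_mem_submodule (x : PS ℂ n) : x.rep ∈ x.submodule :=
  mem_submodule_iff.2 ⟨1, one_smul _ _⟩

lemma submodule_le_iff {x : PS ℂ n} {W : Submodule ℂ (Fin (n + 1) → ℂ)} :
    x.submodule ≤ W ↔ x.rep ∈ W := by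
  rw [Projectivization.submodule_eq, Submodule.span_singleton_le_iff_mem]

lemma eq_of_mem_submodule {x y : PS ℂ n} {v : Fin (n + 1) → ℂ} (hv : v ≠ 0)
    (hx : v ∈ x.submodule) (hy : v ∈ y.submodule) : x = y := by
  obtain ⟨a, rfl⟩ := mem_submodule_iff.1 hx
  obtain ⟨b, hb⟩ := mem_submodule_iff.1 hy
  have ha : a ≠ 0 := by rintro rfl; simp at hv
  rw [← x.mk_rep, ← y.mk_rep, Projectivization.mk_eq_mk_iff']
  exact ⟨a⁻¹ * b, by rw [mul_smul, hb, inv_smul_smul₀ ha]⟩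

/-- The affine cone over a set of projective points. -/
def cone (δ : Set (PS ℂ n)) : Set (Fin (n + 1) → ℂ) := {v | ∃ x ∈ δ, v ∈ x.submodule}

lemma rep_mem_cone {x : PS ℂ n} : x.rep ∈ cone δ ↔ x ∈ δ := by
  refine ⟨?_, fun h => ⟨x, h, rep_mem_submodule x⟩⟩
  rintro ⟨y, hy, h⟩
  rwa [eq_of_mem_submodule x.rep_nonzero (rep_mem_submodule x) h]

lemma projDistinct_rep {ι : Type*} {x : ι → PS ℂ n} (hx : Function.Injective x) :
    ProjDistinct fun i => (x i).rep :=
  ⟨fun i => (x i).rep_nonzero, fun i _ hij c h => hij <| hx <|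
    eq_of_mem_submodule (x i).rep_nonzero (rep_mem_submodule _)
      (mem_submodule_iff.2 ⟨c, h.symm⟩)⟩

lemma mem_projZeroLocus_singleton {f : MvPolynomial (Fin (n + 1)) ℂ} {k : ℕ}
    (hf : f.IsHomogeneous k) {x : PS ℂ n} :
    x ∈ projZeroLocus {f} ↔ eval x.rep f = 0 := by
  refine ⟨fun h => h f rfl _ (rep_mem_submodule x), ?_⟩
  rintro h _ rfl v hv
  obtain ⟨c, rfl⟩ := mem_submodule_iff.1 hv
  rw [eval_smul_of_isHomogeneous hf, h, mul_zero]

lemma isAlg_projZeroLocus_singleton {f : MvPolynomial (Fin (n + 1)) ℂ} {k : ℕ}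
    (hf : f.IsHomogeneous k) : IsAlg (projZeroLocus {f}) :=
  ⟨{f}, by rintro _ rfl; exact ⟨k, hf⟩, rfl⟩

lemma vanishesOn_cone_iff {f : MvPolynomial (Fin (n + 1)) ℂ} {k : ℕ}
    (hf : f.IsHomogeneous k) : VanishesOn (cone δ) f ↔ δ ⊆ projZeroLocus {f} := by
  constructor
  · intro h x hx
    exact (mem_projZeroLocus_singleton hf).2 (h _ (rep_mem_cone.2 hx))
  · rintro h v ⟨x, hx, hv⟩
    exact h hx f rfl v hv

lemma isIrredCone_cone (h : IsIrredAlg δ) : IsIrredCone (cone δ) where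
  irred f g i j hf hg hfg := by
    rw [vanishesOn_cone_iff hf, vanishesOn_cone_iff hg]
    refine h.2.2 _ _ (isAlg_projZeroLocus_singleton hf) (isAlg_projZeroLocus_singleton hg) ?_
    intro x hx
    have := hfg _ (rep_mem_cone.2 hx)
    rw [map_mul, mul_eq_zero] at this
    exact this.imp (mem_projZeroLocus_singleton hf).2 (mem_projZeroLocus_singleton hg).2
  closed v hv := by
    obtain ⟨⟨S, hS, rfl⟩, ⟨x, hx⟩, -⟩ := h
    by_cases h0 : v = 0
    · exact ⟨x, hx, h0 ▸ zero_mem _⟩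
    · have hvm : v ∈ (Projectivization.mk ℂ v h0).submodule := by
        rw [Projectivization.submodule_mk]; exact Submodule.mem_span_singleton_self v
      refine ⟨_, ?_, hvm⟩
      intro f hf w hw
      rw [Projectivization.submodule_mk] at hw
      obtain ⟨c, rfl⟩ := Submodule.mem_span_singleton.1 hw
      obtain ⟨k, hk⟩ := hS f hf
      rw [eval_smul_of_isHomogeneous hk, hv f k hk, mul_zero]
      rintro w ⟨y, hy, hwy⟩
      exact hy f hf w hwy

lemma not_cone_subset_of_nonPlanar (hn : 2 ≤ n) (h : NonPlanar δ)
    (W : Submodule ℂ (Fin (n + 1) → ℂ)) (hW : Module.finrank ℂ W ≤ 3) : ¬ cone δ ⊆ W := by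
  intro hδ
  have key : ∀ k, k ≤ n + 1 → Module.finrank ℂ W ≤ k →
      ∃ W' : Submodule ℂ (Fin (n + 1) → ℂ), W ≤ W' ∧ Module.finrank ℂ W' = k := by
    intro k hk hWk
    induction k, hWk using Nat.le_induction with
    | base => exact ⟨W, le_rfl, rfl⟩
    | succ k hWk ih =>
      obtain ⟨W', hle, hr⟩ := ih (by omega)
      have hlt : W' < ⊤ := Submodule.lt_top_of_finrank_lt_finrank (by simp [hr]; omega)
      obtain ⟨v, -, hv⟩ := SetLike.exists_of_lt hlt
      refine ⟨W' ⊔ Submodule.span ℂ {v}, hle.trans le_sup_left, ?_⟩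
      rw [Submodule.finrank_sup_span_singleton hv, hr]
  obtain ⟨W', hle, hr⟩ := key 3 (by omega) hW
  refine h _ ⟨W', hr, rfl⟩ fun x hx => ?_
  exact submodule_le_iff.2 (hle (hδ (rep_mem_cone.2 hx)))

lemma finite_and_ncard_le {α : Type*} {T : Set α} {k : ℕ}
    (h : ∀ N (x : Fin N → α), Function.Injective x → (∀ i, x i ∈ T) → N ≤ k) :
    T.Finite ∧ T.ncard ≤ k := by
  have hfin : T.Finite := by
    by_contra hT
    have hT : T.Infinite := hT
    have := hT.to_subtype
    have := h (k + 1) (fun i => (Infinite.natEmbedding T i : α))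
      (Subtype.val_injective.comp ((Infinite.natEmbedding T).injective.comp Fin.val_injective))
      fun i => Subtype.property _
    omega
  refine ⟨hfin, ?_⟩
  have := hfin.to_subtype
  exact h _ (fun i => ((Finite.equivFin T).symm i : α))
    (Subtype.val_injective.comp (Equiv.injective _)) fun i => Subtype.property _

lemma finite_zeros {f : MvPolynomial (Fin (n + 1)) ℂ} {k : ℕ} (h : ZerosLE (cone δ) f k) :
    {y ∈ δ | eval y.rep f = 0}.Finite :=
  (finite_and_ncard_le fun N _ hx hxT => h N _ (projDistinct_rep hx) fun i =>
    ⟨rep_mem_cone.2 (hxT i).1, (hxT i).2⟩).1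

lemma exists_projDistinct (h : δ.Infinite) (N : ℕ) :
    ∃ v : Fin N → Fin (n + 1) → ℂ, ProjDistinct v ∧ ∀ i, v i ∈ cone δ := by
  have := h.to_subtype
  refine ⟨fun i => (Infinite.natEmbedding δ i : PS ℂ n).rep, projDistinct_rep
    (Subtype.val_injective.comp ((Infinite.natEmbedding δ).injective.comp Fin.val_injective)),
    fun i => rep_mem_cone.2 (Subtype.property _)⟩

lemma exists_ker_eq {V : Type*} [AddCommGroup V] [Module ℂ V] [FiniteDimensional ℂ V]
    (W : Submodule ℂ V) (k : ℕ)
    (h : Module.finrank ℂ W + k = Module.finrank ℂ V) :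
    ∃ f : V →ₗ[ℂ] (Fin k → ℂ), LinearMap.ker f = W := by
  have hq : Module.finrank ℂ (V ⧸ W) = Module.finrank ℂ (Fin k → ℂ) := by
    have := W.finrank_quotient_add_finrank
    simp
    omega
  refine ⟨(LinearEquiv.ofFinrankEq _ _ hq).toLinearMap ∘ₗ W.mkQ, ?_⟩
  rw [LinearEquiv.ker_comp, Submodule.ker_mkQ]

lemma infinite_of_isPureCurve (h : IsIrredAlg δ) (hδ : IsPureCurve δ) : δ.Infinite :=
  hδ.2.2 δ ⟨h, subset_rfl, fun _ _ h₁ h₂ => h₂.antisymm h₁⟩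

/-- Two hyperplanes that meet a projective curve in disjoint finite sets. -/
lemma exists_functionals (h : IsIrredAlg δ) (hδ : IsPureCurve δ) :
    ∃ l m : (Fin (n + 1) → ℂ) →ₗ[ℂ] ℂ, (∃ v ∈ cone δ, l v ≠ 0) ∧
      ∀ v ∈ cone δ, l v = 0 → m v = 0 → v = 0 := by
  obtain ⟨S, ⟨W, hW, rfl⟩, hfin⟩ := hδ.2.1
  obtain ⟨f, hf⟩ := exists_ker_eq W 1 (by simp [hW])
  let l : (Fin (n + 1) → ℂ) →ₗ[ℂ] ℂ := LinearMap.proj 0 ∘ₗ f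
  have hl : ∀ v, l v = 0 ↔ v ∈ W := by
    intro v
    rw [← hf, LinearMap.mem_ker]
    refine ⟨fun h => ?_, fun h => by simp [l, h]⟩
    ext i
    rw [Subsingleton.elim i 0]
    exact h
  have := hfin.to_subtype
  obtain ⟨m, hm⟩ := Module.exists_dual_forall_apply_ne_zero (K := ℂ)
    (fun y : (δ ∩ {x | x.submodule ≤ W} : Set (PS ℂ n)) => (y : PS ℂ n).rep)
    fun y => (y : PS ℂ n).rep_nonzero
  refine ⟨l, m, ?_, ?_⟩
  · by_contra! hc
    refine infinite_of_isPureCurve h hδ (hfin.subset fun x hx => ⟨hx, ?_⟩)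
    exact submodule_le_iff.2 ((hl _).1 (hc _ (rep_mem_cone.2 hx)))
  · rintro v ⟨x, hx, hv⟩ hlv hmv
    by_contra h0
    obtain ⟨c, rfl⟩ := mem_submodule_iff.1 hv
    have hc : c ≠ 0 := by rintro rfl; simp at h0
    rw [map_smul, smul_eq_zero, or_iff_right hc] at hlv hmv
    exact hm ⟨x, hx, submodule_le_iff.2 ((hl _).1 hlv)⟩ hmv

lemma le_degree {e r : ℕ} (he : IsCurveDeg δ e) {u : (Fin (n + 1) → ℂ) →ₗ[ℂ] ℂ}
    {v : Fin r → Fin (n + 1) → ℂ} (hu : ¬ VanishesOn (cone δ) (linPoly u)) {k : ℕ}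
    (hk : ZerosLE (cone δ) (linPoly u) k) (hv : ProjDistinct v)
    (hvu : ∀ i, v i ∈ cone δ ∧ u (v i) = 0) : r ≤ e := by
  have hu0 : u ≠ 0 := by
    rintro rfl
    exact hu fun v _ => by simp
  have hker : Module.finrank ℂ (LinearMap.ker u) = n := by
    have h1 := u.finrank_range_add_finrank_ker
    rw [LinearMap.range_eq_top.2 (LinearMap.surjective hu0)] at h1
    simp at h1
    omega
  have hset : δ ∩ {x | x.submodule ≤ LinearMap.ker u} =
      {y ∈ δ | eval y.rep (linPoly u) = 0} := by
    ext y
    simp [submodule_le_iff]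
  have hfin := finite_zeros hk
  choose x hx hxv using fun i => (hvu i).1
  have hxinj : Function.Injective x := by
    intro i j hij
    by_contra hne
    obtain ⟨a, ha⟩ := mem_submodule_iff.1 (hxv i)
    obtain ⟨b, hb⟩ := mem_submodule_iff.1 (hxv j)
    have hb0 : b ≠ 0 := by
      rintro rfl
      exact hv.1 j (by rw [← hb, zero_smul])
    refine hv.2 i j hne (a * b⁻¹) ?_
    rw [← ha, ← hb, smul_smul, hij, mul_assoc, inv_mul_cancel₀ hb0, mul_one]
  have hle : r ≤ {y ∈ δ | eval y.rep (linPoly u) = 0}.ncard := by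
    have h1 : (Set.range x).ncard = r := by
      rw [← Set.image_univ, Set.ncard_image_of_injective _ hxinj, Set.ncard_univ]
      simp
    rw [← h1]
    refine Set.ncard_le_ncard ?_ hfin
    rintro _ ⟨i, rfl⟩
    refine ⟨hx i, ?_⟩
    obtain ⟨a, ha⟩ := mem_submodule_iff.1 (hxv i)
    have h2 := (hvu i).2
    have ha0 : a ≠ 0 := by
      rintro rfl
      exact hv.1 i (by rw [← ha, zero_smul])
    rw [← ha, map_smul, smul_eq_zero, or_iff_right ha0] at h2
    simpa using h2
  exact hle.trans (he.2.2 ⟨_, ⟨_, hker, rfl⟩, hset ▸ hfin, by rw [hset]⟩)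

lemma isBad_of_not_genOneToOneOn {δ : Set (PS ℂ (n + 1))} (hδ : IsIrredCone (cone δ))
    (hfin : ∀ a k, a.IsHomogeneous k → ¬ VanishesOn (cone δ) a →
      {y ∈ δ | eval y.rep a = 0}.Finite) {x : PS ℂ (n + 1)}
    (hx : ∀ f : (Fin (n + 2) → ℂ) →ₗ[ℂ] (Fin (n + 1) → ℂ),
      LinearMap.ker f = x.submodule → ¬GenOneToOneOn f δ) : IsBad (cone δ) x.rep := by
  intro a k ha haZ
  obtain ⟨f, hf⟩ := exists_ker_eq x.submodule (n + 1) (by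
    rw [Projectivization.finrank_submodule]; simp; omega)
  have hng := hx f hf
  simp only [GenOneToOneOn, not_exists, not_and] at hng
  have hS := hng _ (hfin a k ha haZ)
  push Not at hS
  obtain ⟨y₁, h₁, y₂, h₂, ⟨c, hc, hcf⟩, hne⟩ := hS
  have hker : y₁.rep - c • y₂.rep ∈ x.submodule := by
    rw [← hf, LinearMap.mem_ker, map_sub, map_smul, hcf, sub_self]
  obtain ⟨κ, hκ⟩ := mem_submodule_iff.1 hker
  have hκ0 : κ ≠ 0 := by
    rintro rfl
    refine hne (eq_of_mem_submodule y₁.rep_nonzero (rep_mem_submodule y₁)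
      (mem_submodule_iff.2 ⟨c, ?_⟩))
    rw [zero_smul] at hκ
    exact (sub_eq_zero.1 hκ.symm).symm
  refine ⟨y₂.rep, rep_mem_cone.2 h₂.1, fun h0 => h₂.2 ⟨h₂.1, h0⟩, κ⁻¹ * c, ?_⟩
  have : x.rep + (κ⁻¹ * c) • y₂.rep = κ⁻¹ • y₁.rep := by
    rw [mul_smul, ← inv_smul_smul₀ hκ0 x.rep, hκ, ← smul_add, sub_add_cancel]
  rw [this]
  exact hδ.smul_mem (rep_mem_cone.2 h₁.1) _

end Projective

end ProjCurve

/-- Lemma 2.3.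
Let `δ` be an irreducible non-planar curve of degree `e` in `ℂPᵈ`, `d ≥ 3` (below `d = n + 1`
with `n ≥ 2`). Then there are at most `O(e^3)` points `x ∉ δ` such that the projection `π_x`
restricted to `δ` is not generically one-to-one. -/
theorem projection_from_off_curve_point_gen_one_to_one :
    ∃ C : ℝ, 0 < C ∧ ∀ n : ℕ, 2 ≤ n → ∀ e : ℕ, ∀ δ : Set (PS ℂ (n + 1)),
      IsIrredAlg δ → NonPlanar δ → IsCurveDeg δ e →
      ({x : PS ℂ (n + 1) | x ∉ δ ∧ ∀ f : (Fin (n + 2) → ℂ) →ₗ[ℂ] (Fin (n + 1) → ℂ),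
          LinearMap.ker f = x.submodule → ¬GenOneToOneOn f δ}).Finite ∧
      (({x : PS ℂ (n + 1) | x ∉ δ ∧ ∀ f : (Fin (n + 2) → ℂ) →ₗ[ℂ] (Fin (n + 1) → ℂ),
          LinearMap.ker f = x.submodule → ¬GenOneToOneOn f δ}).ncard : ℝ) ≤
        C * (e : ℝ) ^ 3 := by
  refine ⟨8, by norm_num, fun n hn e δ hirr hnp hdeg => ?_⟩
  have hZ := ProjCurve.isIrredCone_cone hirr
  obtain ⟨l, m, hl, hlm⟩ := ProjCurve.exists_functionals hirr hdeg.1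
  obtain ⟨r, ⟨u, v, hu, hv, hvu⟩, hzeros, hbad⟩ := hZ.exists_degree hl hlm
    (ProjCurve.exists_projDistinct (ProjCurve.infinite_of_isPureCurve hirr hdeg.1))
    (ProjCurve.not_cone_subset_of_nonPlanar (by omega) hnp)
  have hre : r ≤ e := ProjCurve.le_degree hdeg hu
    (hzeros _ 1 (ProjCurve.isHomogeneous_linPoly u) hu) hv hvu
  have hcard : r * (2 * (4 * r - 1)) ≤ 8 * e ^ 3 :=
    calc r * (2 * (4 * r - 1)) ≤ r * (2 * (4 * r)) := by gcongr; omega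
      _ = 8 * r ^ 2 := by ring
      _ ≤ 8 * e ^ 2 := by gcongr
      _ ≤ 8 * e ^ 3 := by
        rcases Nat.eq_zero_or_pos e with rfl | he
        · simp
        · gcongr
          norm_num
  obtain ⟨hfin, hle⟩ := ProjCurve.finite_and_ncard_le
    (T := {x : PS ℂ (n + 1) | x ∉ δ ∧ ∀ f : (Fin (n + 2) → ℂ) →ₗ[ℂ] (Fin (n + 1) → ℂ),
      LinearMap.ker f = x.submodule → ¬GenOneToOneOn f δ}) fun N x hx hxT =>
    hbad N _ (ProjCurve.projDistinct_rep hx) (fun i h => (hxT i).1 (ProjCurve.rep_mem_cone.1 h))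
      fun i => ProjCurve.isBad_of_not_genOneToOneOn hZ
        (fun a k ha haZ => ProjCurve.finite_zeros (hzeros a k ha haZ)) (hxT i).2
  exact ⟨hfin, by exact_mod_cast hle.trans hcard⟩
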